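/- Let A = kQ/I be a non simply connected toupie algebra with m = dim_k e_0 A e_∞ = 1 such that the branch w_1 lies in the ideal I. If A is a laura algebra, then w_1 is the unique branch of Q lying in I. -/

import Mathlib

/-!
Formalization preamble for "Toupie algebras".

We realize the bound quiver algebra `A = kQ/I` of a toupie quiver `Q` concretely:
the path algebra `kQ` is realized, via its (faithful) left regular representation,
as the subalgebra of `Module.End k (paths → k)` generated by the operators of left
multiplication by the trivial paths `e_v` and by the arrows of `Q`.  Paths are
composed from left to right (`p * q` = "first `p`, then `q`"), as in
Assem–Simson–Skowroński, so that paths from the source `0` to the sink `∞` span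
`e₀ (kQ) e∞`, and (right) `A`-modules are identified with representations of `(Q, I)`.
Right `A`-modules are formalized as (left) modules over `Aᵐᵒᵖ`.
-/

set_option synthInstance.maxHeartbeats 400000
set_option maxHeartbeats 800000

noncomputable section
open scoped Classical
open MulOpposite

universe u

namespace Toupie

/-- Vertices of a toupie quiver with `t` branches, branch `i` having length `ℓ i ≥ 1`:
the unique source `src`, the unique sink `snk`, and for each branch `i` its interior
vertices `mid i a` (the `(a+1)`-st vertex on branch `i`, for `a : Fin (ℓ i - 1)`). -/
inductive Vtx (t : ℕ) (ℓ : Fin t → ℕ) : Type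
  | src : Vtx t ℓ
  | snk : Vtx t ℓ
  | mid (i : Fin t) (a : Fin (ℓ i - 1)) : Vtx t ℓ

/-- The `a`-th vertex on branch `i`, for `0 ≤ a ≤ ℓ i`
(`a = 0` is the source, `a = ℓ i` is the sink). -/
def vtx (t : ℕ) (ℓ : Fin t → ℕ) (i : Fin t) (a : ℕ) : Vtx t ℓ :=
  if a = 0 then .src else if h : a - 1 < ℓ i - 1 then .mid i ⟨a - 1, h⟩ else .snk

/-- The paths of a toupie quiver: trivial paths at the vertices, and for each branch
`i` and `a < b ≤ ℓ i` the path `sub i a b` along branch `i` from its `a`-th vertex to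
its `b`-th vertex.  (`sub i 0 (ℓ i)` is the `i`-th branch `w i`.) -/
inductive PIdx (t : ℕ) (ℓ : Fin t → ℕ) : Type
  | vert (v : Vtx t ℓ) : PIdx t ℓ
  | sub (i : Fin t) (a b : ℕ) (hab : a < b) (hb : b ≤ ℓ i) : PIdx t ℓ

variable (k : Type u) [Field k] (t : ℕ) (ℓ : Fin t → ℕ)

/-- The vector space with basis the set of paths of the toupie quiver. -/
abbrev PSp : Type u := PIdx t ℓ → k

variable {t ℓ}

/-- The starting vertex of a path. -/
def startIdx : PIdx t ℓ → Vtx t ℓ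
  | .vert v => v
  | .sub i a _ _ _ => vtx t ℓ i a

/-- Left multiplication by the trivial path (primitive idempotent) `e_v`. -/
def Ev (v : Vtx t ℓ) : Module.End k (PSp k t ℓ) where
  toFun f := fun p => if startIdx p = v then f p else 0
  map_add' f g := by funext p; by_cases h : startIdx p = v <;> simp [h]
  map_smul' c f := by funext p; by_cases h : startIdx p = v <;> simp [h]

/-- Strip the `j`-th arrow of branch `i` (the arrow `vtx i j ⟶ vtx i (j+1)`) from the
front of a path, if possible. -/
def strip (i : Fin t) (j : ℕ) : PIdx t ℓ → Option (PIdx t ℓ)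
  | .vert _ => none
  | .sub i' a b _ hb =>
      if h : i' = i ∧ a = j then
        if hb2 : j + 1 < b then some (.sub i (j + 1) b hb2 (h.1 ▸ hb))
        else some (.vert (vtx t ℓ i b))
      else none

/-- Left multiplication by the `j`-th arrow of branch `i`
(the arrow from `vtx i j` to `vtx i (j+1)`, for `j < ℓ i`; the zero operator for junk `j`). -/
def Ar (i : Fin t) (j : ℕ) : Module.End k (PSp k t ℓ) where
  toFun f := fun p => (strip i j p).elim 0 f
  map_add' f g := by funext p; rcases h : strip i j p with _ | q <;> simp [h]
  map_smul' c f := by funext p; rcases h : strip i j p with _ | q <;> simp [h]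

variable (t ℓ)

/-- The generators of the path algebra: the trivial paths and the arrows. -/
def gens : Set (Module.End k (PSp k t ℓ)) :=
  Set.range (Ev k) ∪ {x | ∃ i j, x = Ar k i j}

/-- The path algebra `kQ` of the toupie quiver, realized as the subalgebra of
`Module.End k (PSp k t ℓ)` generated by left multiplication by trivial paths and arrows. -/
def PathAlg : Subalgebra k (Module.End k (PSp k t ℓ)) :=
  Algebra.adjoin k (gens k t ℓ)

variable {k t ℓ}

/-- The trivial path `e_v` as an element of the path algebra. -/
def eV (v : Vtx t ℓ) : PathAlg k t ℓ :=
  ⟨Ev k v, Algebra.subset_adjoin (Or.inl ⟨v, rfl⟩)⟩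

/-- The `j`-th arrow of branch `i` as an element of the path algebra. -/
def arE (i : Fin t) (j : ℕ) : PathAlg k t ℓ :=
  ⟨Ar k i j, Algebra.subset_adjoin (Or.inr ⟨i, j, rfl⟩)⟩

/-- The path along branch `i` from its `a`-th vertex to its `b`-th vertex, as an element
of the path algebra: the product (composed from left to right) of the arrows
`a → a+1 → ⋯ → b`.  (For `b ≤ a` this is the empty product `1`.) -/
def subE (i : Fin t) (a b : ℕ) : PathAlg k t ℓ :=
  (((List.range (b - a)).map fun s => arE i (a + s)).prod)

/-- The `i`-th branch `w i` (the path from the source to the sink along branch `i`)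
as an element of the path algebra. -/
def wE (i : Fin t) : PathAlg k t ℓ := subE i 0 (ℓ i)

variable {k : Type u} [Field k]

/-- A toupie algebra `A = kQ/I`: a toupie quiver `Q` (a non-linear quiver with a unique
source, a unique sink, and all other vertices having exactly one incoming and one
outgoing arrow, i.e. `t ≥ 2` branches of lengths `ℓ i ≥ 1`), together with an admissible
ideal `I` of the path algebra `kQ`.  Since `Q` is finite and acyclic, the arrow ideal is
nilpotent, so admissibility amounts to `I ⊆ R_Q²`, i.e. every element of `I` is a linear
combination of paths of length `≥ 2`. -/
structure ToupieAlg (k : Type u) [Field k] : Type u where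
  t : ℕ
  ht : 2 ≤ t
  ℓ : Fin t → ℕ
  hℓ : ∀ i, 1 ≤ ℓ i
  I : TwoSidedIdeal (PathAlg k t ℓ)
  adm : ∀ x ∈ I, x ∈ Submodule.span k
    {y : PathAlg k t ℓ | ∃ i a b, a + 2 ≤ b ∧ b ≤ ℓ i ∧ y = subE i a b}

variable (T : ToupieAlg k)

/-- The underlying algebra `A = kQ/I` of a toupie algebra. -/
def Alg : Type u := T.I.ringCon.Quotient

instance : Ring (Alg T) := inferInstanceAs (Ring T.I.ringCon.Quotient)

/-- The quotient map `kQ → A = kQ/I`. -/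
def mkA : PathAlg k T.t T.ℓ →+* Alg T := T.I.ringCon.mk'

lemma mkA_surjective : Function.Surjective (mkA T) := Quotient.mk''_surjective

instance : Algebra k (Alg T) :=
  RingHom.toAlgebra' ((mkA T).comp (algebraMap k (PathAlg k T.t T.ℓ)))
    (by
      intro c x
      obtain ⟨y, rfl⟩ := mkA_surjective T x
      simp only [RingHom.coe_comp, Function.comp_apply, ← map_mul]
      rw [Algebra.commutes])

/-- The idempotent `e₀` (at the source) in `A`. -/
def e0 : Alg T := mkA T (eV Vtx.src)

/-- The idempotent `e∞` (at the sink) in `A`. -/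
def einf : Alg T := mkA T (eV Vtx.snk)

/-- The `k`-linear map `A → A`, `x ↦ e₀ * x * e∞`, whose range is `e₀ A e∞`. -/
def lrMap : Alg T →ₗ[k] Alg T where
  toFun x := e0 T * x * einf T
  map_add' x y := by simp [mul_add, add_mul]
  map_smul' c x := by
    simp only [RingHom.id_apply]
    rw [mul_smul_comm, smul_mul_assoc]

/-- `m = dim_k e₀ A e∞`, the dimension of the span of the (residues of the) paths from
the source to the sink. -/
def mDim : ℕ := Module.finrank k ↥(LinearMap.range (lrMap T))

/-- The branch `w i` lies in the ideal `I`. -/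
def branchInI (i : Fin T.t) : Prop := wE i ∈ T.I

/-- A minimal relation: `∑_{i ∈ J} λ i • w i ∈ I` with `|J| ≥ 2`, all `λ i ≠ 0`, and no
nonempty proper subsum in `I`. -/
def MinRel (J : Finset (Fin T.t)) (lam : Fin T.t → k) : Prop :=
  2 ≤ J.card ∧ (∀ i ∈ J, lam i ≠ 0) ∧ (∑ i ∈ J, lam i • wE i) ∈ T.I ∧
    ∀ J' ⊂ J, J'.Nonempty → (∑ i ∈ J', lam i • wE i) ∉ T.I

/-- A toupie algebra is simply connected if any two distinct branches are involved in a
common minimal relation. -/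
def SimplyConnected : Prop :=
  ∀ i j : Fin T.t, i ≠ j → ∃ J lam, MinRel T J lam ∧ i ∈ J ∧ j ∈ J

/-- A (minimal) zero-relation on branch `i`: the subpath of branch `i` from its `a`-th
to its `b`-th vertex lies in `I`, but no proper subpath of it does. -/
def ZeroRel (i : Fin T.t) (a b : ℕ) : Prop :=
  a < b ∧ b ≤ T.ℓ i ∧ subE i a b ∈ T.I ∧
    ∀ a' b', a ≤ a' → b' ≤ b → a' < b' → (a', b') ≠ (a, b) → subE i a' b' ∉ T.I

/-- There is exactly one relation on branch `i`. -/
def ExactlyOneRel (i : Fin T.t) : Prop := ∃! p : ℕ × ℕ, ZeroRel T i p.1 p.2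

/-- Branch `i` carries more than one relation. -/
def MoreThanOneRel (i : Fin T.t) : Prop :=
  ∃ p q : ℕ × ℕ, p ≠ q ∧ ZeroRel T i p.1 p.2 ∧ ZeroRel T i q.1 q.2

/-- At most one branch of `Q` has length at least three. -/
def AtMostOneLongBranch : Prop := ∀ i j : Fin T.t, 3 ≤ T.ℓ i → 3 ≤ T.ℓ j → i = j

/-- The two-sided ideal `I` is generated by the set `S`. -/
def IsGenBy {R : Type u} [Ring R] (I : TwoSidedIdeal R) (S : Set R) : Prop :=
  S ⊆ (I : Set R) ∧ ∀ J : TwoSidedIdeal R, S ⊆ (J : Set R) → (I : Set R) ⊆ (J : Set R)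

/-- A toupie algebra is canonical if (after choosing two distinguished branches `i₁, i₂`)
its ideal is generated by `{w i₁ + λ j • w i₂ - w j}` over the remaining branches `j`,
with the `λ j` pairwise distinct and nonzero. -/
def IsCanonical : Prop :=
  ∃ (i₁ i₂ : Fin T.t) (lam : Fin T.t → k), i₁ ≠ i₂ ∧
    (∀ j, j ≠ i₁ → j ≠ i₂ → lam j ≠ 0) ∧
    (∀ j j', j ≠ i₁ → j ≠ i₂ → j' ≠ i₁ → j' ≠ i₂ → j ≠ j' → lam j ≠ lam j') ∧
    IsGenBy T.I {x | ∃ j, j ≠ i₁ ∧ j ≠ i₂ ∧ x = wE i₁ + lam j • wE i₂ - wE j}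

end Toupie
namespace Toupie

/-! ### Module-theoretic notions over an arbitrary ring

Following the paper, all modules are finite-dimensional *right* modules; a right
`A`-module is formalized as a (left) module over `Aᵐᵒᵖ`.  The definitions below are
stated for modules over an arbitrary ring `R` and are applied with `R := Aᵐᵒᵖ`. -/

variable (R : Type u) [Ring R]

/-- A module is indecomposable if it is nonzero and its only idempotent endomorphisms
are `0` and the identity. -/
def Indec (M : ModuleCat.{u} R) : Prop :=
  Nontrivial M ∧ ∀ f : M →ₗ[R] M, f.comp f = f → f = 0 ∨ f = LinearMap.id

/-- Finiteness ("finite dimensionality") of a module. -/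
def FdMod (M : ModuleCat.{u} R) : Prop := Module.Finite R M

/-- `M` has projective dimension at most one: it is the quotient of a projective module
by a projective submodule. -/
def PdLeOne (M : ModuleCat.{u} R) : Prop :=
  ∃ (P : ModuleCat.{u} R) (f : P →ₗ[R] M), Function.Surjective f ∧
    Module.Projective R P ∧ Module.Projective R ↥(LinearMap.ker f)

/-- `M` has injective dimension at most one: it embeds in an injective module with
injective cokernel. -/
def IdLeOne (M : ModuleCat.{u} R) : Prop :=
  ∃ (E : ModuleCat.{u} R) (f : M →ₗ[R] E), Function.Injective f ∧
    Module.Injective R E ∧ Module.Injective R (E ⧸ LinearMap.range f)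

/-- One step of a path in `ind R`: a nonzero non-isomorphism between (finite-dimensional)
indecomposable modules. -/
def Step (M N : ModuleCat.{u} R) : Prop :=
  Indec R M ∧ FdMod R M ∧ Indec R N ∧ FdMod R N ∧
    ∃ f : M →ₗ[R] N, f ≠ 0 ∧ ¬ Function.Bijective f

/-- A path in `ind R` from `M` to `N` (possibly trivial): a chain
`M = M₀ → M₁ → ⋯ → Mₙ = N` of nonzero non-isomorphisms between indecomposables. -/
def IndPath (M N : ModuleCat.{u} R) : Prop := Relation.ReflTransGen (Step R) M N

/-- The left part `L_R`: the indecomposable (finite-dimensional) modules `M` such that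
every indecomposable `X` with a path `X ⇝ M` in `ind R` has projective dimension `≤ 1`. -/
def InLeftPart (M : ModuleCat.{u} R) : Prop :=
  Indec R M ∧ FdMod R M ∧
    ∀ X : ModuleCat.{u} R, Indec R X → FdMod R X → IndPath R X M → PdLeOne R X

/-- The right part `R_R`: the indecomposable (finite-dimensional) modules `M` such that
every indecomposable `X` with a path `M ⇝ X` in `ind R` has injective dimension `≤ 1`. -/
def InRightPart (M : ModuleCat.{u} R) : Prop :=
  Indec R M ∧ FdMod R M ∧
    ∀ X : ModuleCat.{u} R, Indec R X → FdMod R X → IndPath R M X → IdLeOne R X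

/-- Hereditary: global dimension at most one, i.e. every module has projective dimension
at most one. -/
def Hereditary : Prop := ∀ M : ModuleCat.{u} R, PdLeOne R M

/-- Quasitilted: every indecomposable projective module lies in the left part. -/
def Quasitilted : Prop :=
  ∀ P : ModuleCat.{u} R, Indec R P → FdMod R P → Module.Projective R P → InLeftPart R P

/-- A module is directed if it lies on no cycle of nonzero non-isomorphisms between
indecomposables in `ind R`. -/
def Directed (M : ModuleCat.{u} R) : Prop := ¬ Relation.TransGen (Step R) M M

/-- Weakly shod: every indecomposable (finite-dimensional) module not lying in
`L_R ∪ R_R` is directed. -/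
def WeaklyShod : Prop :=
  ∀ M : ModuleCat.{u} R, Indec R M → FdMod R M →
    ¬ InLeftPart R M → ¬ InRightPart R M → Directed R M

/-- Laura: all but finitely many isomorphism classes of indecomposable
(finite-dimensional) modules lie in `L_R ∪ R_R`. -/
def Laura : Prop :=
  ∃ S : Set (ModuleCat.{u} R), S.Finite ∧
    ∀ M : ModuleCat.{u} R, Indec R M → FdMod R M →
      ¬ InLeftPart R M → ¬ InRightPart R M → ∃ N ∈ S, Nonempty (M ≃ₗ[R] N)

/-- There are exactly `n` isomorphism classes of modules satisfying `P`. -/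
def NumClasses (P : ModuleCat.{u} R → Prop) (n : ℕ) : Prop :=
  ∃ f : Fin n → ModuleCat.{u} R, (∀ i, P (f i)) ∧
    (∀ i j, Nonempty ((f i : Type u) ≃ₗ[R] (f j : Type u)) → i = j) ∧
    ∀ M : ModuleCat.{u} R, P M → ∃ i, Nonempty ((M : Type u) ≃ₗ[R] (f i : Type u))

/-- `M` is (isomorphic to) a direct summand of `T`. -/
def IsSummandOf (T : Type u) [AddCommGroup T] [Module R T] (M : ModuleCat.{u} R) : Prop :=
  ∃ N N' : Submodule R T, IsCompl N N' ∧ Nonempty ((M : Type u) ≃ₗ[R] N)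

/-- `Ext¹_R(T, T) = 0`: every self-extension `0 → T → E → T → 0` splits. -/
def SelfExtVanish (T : Type u) [AddCommGroup T] [Module R T] : Prop :=
  ∀ (E : Type u) [AddCommGroup E] [Module R E] (ι : T →ₗ[R] E) (π : E →ₗ[R] T),
    Function.Injective ι → Function.Surjective π → LinearMap.range ι = LinearMap.ker π →
      ∃ s : T →ₗ[R] E, π.comp s = LinearMap.id

/-- A tilting module over a hereditary algebra: a finite module with `Ext¹(T,T) = 0`
having as many pairwise non-isomorphic indecomposable direct summands as there are
simple modules. -/
def IsTiltingMod (T : Type u) [AddCommGroup T] [Module R T] : Prop :=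
  Module.Finite R T ∧ SelfExtVanish R T ∧
    ∃ n : ℕ, NumClasses R (fun M => Indec R M ∧ IsSummandOf R T M) n ∧
      NumClasses R (fun M => IsSimpleModule R M) n

variable (k : Type u) [Field k]

/-- A `k`-algebra `A` is tilted if it is the endomorphism algebra of a tilting (right)
module over a hereditary finite-dimensional `k`-algebra `H`.  (Right `H`-modules are
modules over `Hᵐᵒᵖ`; the isomorphism `A ≅ End_H T` is a `k`-linear ring isomorphism.) -/
def IsTilted (A : Type u) [Ring A] [Algebra k A] : Prop :=
  ∃ (H : Type u) (_ : Ring H) (_ : Algebra k H),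
    FiniteDimensional k H ∧ Hereditary Hᵐᵒᵖ ∧
      ∃ (T : Type u) (_ : AddCommGroup T) (_ : Module Hᵐᵒᵖ T),
        IsTiltingMod Hᵐᵒᵖ T ∧
          ∃ (_ : Module k T) (_ : SMulCommClass Hᵐᵒᵖ k T) (_ : IsScalarTower k Hᵐᵒᵖ T)
            (φ : A ≃+* Module.End Hᵐᵒᵖ T), ∀ (c : k) (x : A), φ (c • x) = c • φ x

end Toupie
namespace Toupie

variable {k : Type u} [Field k] (T : ToupieAlg k)

/-! ### Right `A`-modules as representations of `(Q, I)`

For a right `A`-module `M` (a module over `Aᵐᵒᵖ`) and a vertex `v`, the space of the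
corresponding representation at `v` is `M_v = M • e_v`. -/

/-- The action of the idempotent `e_v ∈ A` on a right `A`-module (= `Aᵐᵒᵖ`-module). -/
def actV (v : Vtx T.t T.ℓ) : (Alg T)ᵐᵒᵖ := op (mkA T (eV v))

/-- The space `M_v = M • e_v` of the representation `M` at the vertex `v` is zero. -/
def VanishAt (M : ModuleCat.{u} (Alg T)ᵐᵒᵖ) (v : Vtx T.t T.ℓ) : Prop :=
  ∀ m : M, actV T v • m = 0

/-- Every simple summand of `top M = M / rad M` is one of the simple modules `S_v`,
`v ∈ vs`: for every maximal submodule `N` the simple quotient `M/N` is supported at some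
vertex of `vs` (for an admissible quotient of a path algebra, the simple module `S_v` is
the unique simple on which `e_v` acts nontrivially). -/
def TopIn (M : ModuleCat.{u} (Alg T)ᵐᵒᵖ) (vs : Set (Vtx T.t T.ℓ)) : Prop :=
  ∀ N : Submodule (Alg T)ᵐᵒᵖ M, IsCoatom N → ∃ v ∈ vs, ∃ m : M, actV T v • m ∉ N

/-- Every simple summand of the socle of `M` is one of the simple modules `S_v`,
`v ∈ vs`: every simple submodule `N ≤ M` is supported at some vertex of `vs`. -/
def SocIn (M : ModuleCat.{u} (Alg T)ᵐᵒᵖ) (vs : Set (Vtx T.t T.ℓ)) : Prop :=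
  ∀ N : Submodule (Alg T)ᵐᵒᵖ M, IsAtom N → ∃ v ∈ vs, ∃ m ∈ N, actV T v • m ≠ 0

/-- The module `D x y` (for two positions `0 ≤ x, y ≤ ℓ i₀` on the unique branch `i₀`
lying in `I`, and an auxiliary branch `i₂ ≠ i₀`): the right `A`-module with generators
`g = e₀` (at the source) and `h = e_y` (at the `y`-th vertex of branch `i₀`), subject to
the relations `g ⬝ (subpath of w i₀ from 0 to x+1) = 0` and
`g ⬝ w i₂ = h ⬝ (subpath of w i₀ from y to ℓ i₀)`.  It is presented as the quotient of
the right regular module `A ⊕ A` by the right submodule generated by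
`(1 - e₀, 0)`, `(0, 1 - e_y)`, `(subE i₀ 0 (min (x+1) (ℓ i₀)), 0)` and
`(w i₂, - subE i₀ y (ℓ i₀))`. -/
abbrev Dmod (i₀ i₂ : Fin T.t) (x y : ℕ) : Type u :=
  (Alg T × Alg T) ⧸ Submodule.span (Alg T)ᵐᵒᵖ
    ({((mkA T (1 - eV Vtx.src) : Alg T), (0 : Alg T)),
      ((0 : Alg T), (mkA T (1 - eV (vtx T.t T.ℓ i₀ y)) : Alg T)),
      ((mkA T (subE i₀ 0 (min (x + 1) (T.ℓ i₀))) : Alg T), (0 : Alg T)),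
      ((mkA T (wE i₂) : Alg T), (- mkA T (subE i₀ y (T.ℓ i₀)) : Alg T))} :
        Set (Alg T × Alg T))

end Toupie

namespace Toupie

section Paths

variable {t : ℕ} {ℓ : Fin t → ℕ}

instance : Finite (Vtx t ℓ) := by
  let F : Vtx t ℓ → Option (Option (Σ i : Fin t, Fin (ℓ i - 1))) := fun v =>
    match v with
    | .src => none
    | .snk => some none
    | .mid i a => some (some ⟨i, a⟩)
  refine Finite.of_injective F ?_
  intro v w h
  cases v <;> cases w <;> simp_all [F]

instance : Finite (PIdx t ℓ) := by
  let F : PIdx t ℓ → Vtx t ℓ ⊕ (Σ i : Fin t, Fin (ℓ i + 1) × Fin (ℓ i + 1)) := fun p =>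
    match p with
    | .vert v => .inl v
    | .sub i a b hab hb => .inr ⟨i, ⟨a, by omega⟩, ⟨b, by omega⟩⟩
  refine Finite.of_injective F ?_
  intro v w h
  cases v with
  | vert v => cases w <;> simp_all [F]
  | sub i a b hab hb =>
    cases w with
    | vert w => simp [F] at h
    | sub i' a' b' hab' hb' =>
      simp only [F, Sum.inr.injEq, Sigma.mk.injEq] at h
      obtain ⟨rfl, h⟩ := h
      simp_all

instance : Fintype (Vtx t ℓ) := Fintype.ofFinite _

instance : Fintype (PIdx t ℓ) := Fintype.ofFinite _

/-- The terminal vertex of a path. -/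
def endIdx : PIdx t ℓ → Vtx t ℓ
  | .vert v => v
  | .sub i _ b _ _ => vtx t ℓ i b

lemma vtx_zero (i : Fin t) : vtx t ℓ i 0 = .src := by simp [vtx]

lemma vtx_of_le {i : Fin t} {a : ℕ} (h0 : 0 < a) (h : ℓ i ≤ a) : vtx t ℓ i a = .snk := by
  simp only [vtx]
  rw [if_neg (by omega), dif_neg (by omega)]

lemma vtx_mid {i : Fin t} {a : ℕ} (h0 : 0 < a) (h : a < ℓ i) :
    vtx t ℓ i a = .mid i ⟨a - 1, by omega⟩ := by
  simp only [vtx]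
  rw [if_neg (by omega), dif_pos]

lemma vtx_injective_left {i i' : Fin t} {a a' : ℕ} (h : vtx t ℓ i a = vtx t ℓ i' a')
    (h0 : 0 < a) (h1 : a < ℓ i) : i = i' ∧ a = a' := by
  rw [vtx_mid h0 h1] at h
  rcases Nat.eq_zero_or_pos a' with rfl | h0'
  · simp [vtx_zero] at h
  rcases lt_or_ge a' (ℓ i') with h1' | h1'
  · rw [vtx_mid h0' h1'] at h
    obtain ⟨rfl, h⟩ := Vtx.mid.inj h
    simp at h
    exact ⟨rfl, by omega⟩
  · rw [vtx_of_le h0' h1'] at h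
    cases h

lemma vtx_injective {i : Fin t} {a a' : ℕ} (h : vtx t ℓ i a = vtx t ℓ i a')
    (h1 : a ≤ ℓ i) (h1' : a' ≤ ℓ i) : a = a' := by
  by_cases ha : 0 < a ∧ a < ℓ i
  · exact (vtx_injective_left h ha.1 ha.2).2
  by_cases ha' : 0 < a' ∧ a' < ℓ i
  · exact (vtx_injective_left h.symm ha'.1 ha'.2).2.symm
  rcases Nat.eq_zero_or_pos a with rfl | h0 <;> rcases Nat.eq_zero_or_pos a' with rfl | h0'
  · rfl
  · rw [vtx_zero, vtx_of_le h0' (by omega)] at h; cases h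
  · rw [vtx_zero, vtx_of_le h0 (by omega)] at h; cases h
  · omega

lemma strip_eq_some {i : Fin t} {j : ℕ} {p q : PIdx t ℓ} (h : strip i j p = some q) :
    ∃ b, ∃ (hab : j < b) (hb : b ≤ ℓ i), p = .sub i j b hab hb ∧
      ((b = j + 1 ∧ q = .vert (vtx t ℓ i (j + 1))) ∨
        ∃ h : j + 1 < b, q = .sub i (j + 1) b h hb) := by
  cases p with
  | vert v => simp [strip] at h
  | sub i' a b hab hb =>
    by_cases h1 : i' = i ∧ a = j
    · obtain ⟨rfl, rfl⟩ := h1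
      by_cases h2 : a + 1 < b
      · exact ⟨b, hab, hb, rfl, Or.inr ⟨h2, by simpa [strip, h2] using h.symm⟩⟩
      · obtain rfl : b = a + 1 := by omega
        exact ⟨_, hab, hb, rfl, Or.inl ⟨rfl, by simpa [strip] using h.symm⟩⟩
    · simp [strip, h1] at h

lemma strip_injective {i : Fin t} {j : ℕ} {p p' q : PIdx t ℓ} (h : strip i j p = some q)
    (h' : strip i j p' = some q) : p = p' := by
  obtain ⟨b, hab, hb, hp, hq⟩ := strip_eq_some h
  obtain ⟨b', hab', hb', hp', hq'⟩ := strip_eq_some h'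
  clear h h'
  subst hp hp'
  rcases hq with ⟨rfl, rfl⟩ | ⟨h, rfl⟩ <;> rcases hq' with ⟨rfl, h'⟩ | ⟨h2, h'⟩ <;> simp_all

lemma exists_strip_eq {i : Fin t} {j : ℕ} (hj : j < ℓ i) {q : PIdx t ℓ}
    (hq : startIdx q = vtx t ℓ i (j + 1)) : ∃ p, strip i j p = some q := by
  cases q with
  | vert v =>
    obtain rfl : v = _ := hq
    exact ⟨.sub i j (j + 1) (by omega) (by omega), by simp [strip]⟩
  | sub i' a b hab hb =>
    change vtx t ℓ i' a = _ at hq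
    rcases Nat.eq_zero_or_pos a with rfl | h0
    · rw [vtx_zero] at hq
      rcases lt_or_ge (j + 1) (ℓ i) with h | h
      · rw [vtx_mid (by omega) h] at hq; cases hq
      · rw [vtx_of_le (by omega) h] at hq; cases hq
    · obtain ⟨rfl, rfl⟩ := vtx_injective_left hq h0 (by omega)
      exact ⟨.sub i' j b (by omega) hb, by simp [strip, hab]⟩

end Paths

section Representations

variable {k : Type u} [Field k] {t : ℕ} {ℓ : Fin t → ℕ} {B : Type*} [Ring B]

/-- The product `α a * α (a + 1) * ⋯ * α (b - 1)`. -/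
def icoProd (α : ℕ → B) (a b : ℕ) : B := ((List.range (b - a)).map fun s => α (a + s)).prod

lemma icoProd_self (α : ℕ → B) (a : ℕ) : icoProd α a a = 1 := by simp [icoProd]

lemma icoProd_cons (α : ℕ → B) {a b : ℕ} (h : a < b) :
    icoProd α a b = α a * icoProd α (a + 1) b := by
  obtain ⟨n, rfl⟩ : ∃ n, b = a + 1 + n := ⟨b - (a + 1), by omega⟩
  simp only [icoProd, show a + 1 + n - a = n + 1 by omega, show a + 1 + n - (a + 1) = n by omega,
    List.range_succ_eq_map, List.map_cons, List.prod_cons, List.map_map]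
  congr 3
  funext s
  simp [show a + (s + 1) = a + 1 + s by omega]

lemma icoProd_succ (α : ℕ → B) (a : ℕ) : icoProd α a (a + 1) = α a := by
  rw [icoProd_cons α (Nat.lt_succ_self a), icoProd_self, mul_one]

lemma icoProd_mul (α : ℕ → B) {a b c : ℕ} (hab : a ≤ b) (hbc : b ≤ c) :
    icoProd α a b * icoProd α b c = icoProd α a c := by
  obtain ⟨n, rfl⟩ : ∃ n, b = a + n := ⟨b - a, by omega⟩
  induction n generalizing a with
  | zero => simp [icoProd_self]
  | succ n ih =>
    rw [icoProd_cons α (show a < a + (n + 1) by omega), icoProd_cons α (show a < c by omega),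
      mul_assoc, show a + (n + 1) = a + 1 + n by omega]
    rw [ih (by omega) (by omega)]

/-- The value of a path in a ring in which the vertices and arrows have been given values. -/
def pathVal (e : Vtx t ℓ → B) (α : Fin t → ℕ → B) : PIdx t ℓ → B
  | .vert v => e v
  | .sub i a b _ _ => icoProd (α i) a b

/-- The relations of the path algebra satisfied by the values of vertices and arrows. -/
structure IsRep (e : Vtx t ℓ → B) (α : Fin t → ℕ → B) : Prop where
  idem : ∀ v, e v * e v = e v
  orth : ∀ v w, v ≠ w → e v * e w = 0
  sum : ∑ v, e v = 1
  left : ∀ i j, j < ℓ i → e (vtx t ℓ i j) * α i j = α i j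
  right : ∀ i j, j < ℓ i → α i j * e (vtx t ℓ i (j + 1)) = α i j
  junk : ∀ i j, ℓ i ≤ j → α i j = 0

variable {e : Vtx t ℓ → B} {α : Fin t → ℕ → B}

lemma IsRep.start_mul (h : IsRep e α) (p : PIdx t ℓ) :
    e (startIdx p) * pathVal e α p = pathVal e α p := by
  cases p with
  | vert v => exact h.idem v
  | sub i a b hab hb =>
    simp only [startIdx, pathVal]
    rw [icoProd_cons _ hab, ← mul_assoc, h.left _ _ (by omega)]

lemma IsRep.mul_end (h : IsRep e α) (p : PIdx t ℓ) :
    pathVal e α p * e (endIdx p) = pathVal e α p := by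
  cases p with
  | vert v => exact h.idem v
  | sub i a b hab hb =>
    simp only [endIdx, pathVal]
    obtain ⟨c, rfl⟩ : ∃ c, b = c + 1 := ⟨b - 1, by omega⟩
    rw [← icoProd_mul (α i) (show a ≤ c by omega) (Nat.le_succ c), icoProd_succ, mul_assoc,
      h.right _ _ (by omega)]

lemma IsRep.vert_mul (h : IsRep e α) (v : Vtx t ℓ) (p : PIdx t ℓ) :
    e v * pathVal e α p = if startIdx p = v then pathVal e α p else 0 := by
  split_ifs with hv
  · rw [← hv, h.start_mul]
  · rw [← h.start_mul p, ← mul_assoc, h.orth _ _ (Ne.symm hv), zero_mul]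

lemma IsRep.mul_vert (h : IsRep e α) (v : Vtx t ℓ) (p : PIdx t ℓ) :
    pathVal e α p * e v = if endIdx p = v then pathVal e α p else 0 := by
  split_ifs with hv
  · rw [← hv, h.mul_end]
  · rw [← h.mul_end p, mul_assoc, h.orth _ _ hv, mul_zero]

lemma IsRep.pathVal_strip (h : IsRep e α) {i : Fin t} {j : ℕ} {p q : PIdx t ℓ}
    (hp : strip i j p = some q) : pathVal e α p = α i j * pathVal e α q := by
  obtain ⟨b, hab, hb, rfl, h'⟩ := strip_eq_some hp
  rcases h' with ⟨rfl, rfl⟩ | ⟨h2, rfl⟩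
  · simp only [pathVal]
    rw [icoProd_succ, h.right _ _ (by omega)]
  · simp only [pathVal]
    rw [icoProd_cons _ hab]

variable [Algebra k B]

/-- The linear extension of `pathVal`. -/
def linVal (k : Type u) [Field k] [Algebra k B] (e : Vtx t ℓ → B) (α : Fin t → ℕ → B) :
    PSp k t ℓ →ₗ[k] B where
  toFun f := ∑ p, f p • pathVal e α p
  map_add' f g := by simp [add_smul, Finset.sum_add_distrib]
  map_smul' c f := by simp [mul_smul, Finset.smul_sum]

lemma linVal_apply (f : PSp k t ℓ) : linVal k e α f = ∑ p, f p • pathVal e α p := rfl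

lemma IsRep.linVal_Ev (h : IsRep e α) (v : Vtx t ℓ) (f : PSp k t ℓ) :
    linVal k e α (Ev k v f) = e v * linVal k e α f := by
  simp only [linVal_apply, Finset.mul_sum, mul_smul_comm, h.vert_mul, Ev, LinearMap.coe_mk,
    AddHom.coe_mk]
  refine Finset.sum_congr rfl fun p _ => ?_
  split_ifs <;> simp

lemma IsRep.linVal_Ar (h : IsRep e α) (i : Fin t) (j : ℕ) (f : PSp k t ℓ) :
    linVal k e α (Ar k i j f) = α i j * linVal k e α f := by
  simp only [linVal_apply, Finset.mul_sum, mul_smul_comm]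
  have h1 : ∀ p : PIdx t ℓ, Ar k i j f p • pathVal e α p =
      ∑ q, if strip i j p = some q then f q • pathVal e α p else 0 := by
    intro p
    change (strip i j p).elim 0 f • _ = _
    rcases hs : strip i j p with _ | q <;> simp
  simp only [h1]
  rw [Finset.sum_comm]
  refine Finset.sum_congr rfl fun q _ => ?_
  by_cases hq : ∃ p, strip i j p = some q
  · obtain ⟨p, hp⟩ := hq
    rw [Finset.sum_eq_single p, if_pos hp, h.pathVal_strip hp]
    · intro p' _ hne
      rw [if_neg fun hp' => hne (strip_injective hp' hp)]
    · simp
  · rw [Finset.sum_eq_zero fun p _ => if_neg fun hp => hq ⟨p, hp⟩]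
    rcases lt_or_ge j (ℓ i) with hj | hj
    · rw [← h.right i j hj, mul_assoc, h.vert_mul, if_neg fun hs => hq (exists_strip_eq hj hs)]
      simp
    · simp [h.junk i j hj]

/-- The identity of the path algebra, as a combination of paths. -/
def onePath (k : Type u) [Field k] (t : ℕ) (ℓ : Fin t → ℕ) : PSp k t ℓ
  | .vert _ => 1
  | .sub .. => 0

lemma IsRep.linVal_one (h : IsRep e α) : linVal k e α (onePath k t ℓ) = 1 := by
  rw [← h.sum, linVal_apply]
  symm
  refine Finset.sum_of_injOn (fun v => PIdx.vert v) ?_ ?_ ?_ ?_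
  · intro v _ w _ hvw
    simpa using hvw
  · simp
  · intro p _ hp
    cases p with
    | vert v => simp at hp
    | sub => simp [onePath]
  · intro v _
    simp [onePath, pathVal]

lemma IsRep.exists_linVal (h : IsRep e α) (x : PathAlg k t ℓ) :
    ∃ b : B, ∀ f : PSp k t ℓ, linVal k e α (x.1 f) = b * linVal k e α f := by
  obtain ⟨x, hx⟩ := x
  induction hx using Algebra.adjoin_induction with
  | mem x hx =>
    rcases hx with ⟨v, rfl⟩ | ⟨i, j, rfl⟩
    · exact ⟨e v, h.linVal_Ev v⟩
    · exact ⟨α i j, h.linVal_Ar i j⟩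
  | algebraMap r => exact ⟨algebraMap k B r, fun f => by
      rw [Module.algebraMap_end_apply, map_smul, Algebra.smul_def]⟩
  | add x y _ _ hx hy =>
    obtain ⟨a, ha⟩ := hx
    obtain ⟨b, hb⟩ := hy
    exact ⟨a + b, fun f => by
      simp only [LinearMap.add_apply, map_add, add_mul]; rw [ha, hb]⟩
  | mul x y _ _ hx hy =>
    obtain ⟨a, ha⟩ := hx
    obtain ⟨b, hb⟩ := hy
    exact ⟨a * b, fun f => by
      simp only [Module.End.mul_apply, mul_assoc]
      rw [ha, hb]⟩

lemma IsRep.linVal_apply_eq (h : IsRep e α) (x : PathAlg k t ℓ) (f : PSp k t ℓ) :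
    linVal k e α (x.1 f) = linVal k e α (x.1 (onePath k t ℓ)) * linVal k e α f := by
  obtain ⟨b, hb⟩ := h.exists_linVal x
  rw [hb, hb, h.linVal_one, mul_one]

/-- The algebra homomorphism determined by the values of the vertices and arrows. -/
def IsRep.lift (h : IsRep e α) : PathAlg k t ℓ →ₐ[k] B where
  toFun x := linVal k e α (x.1 (onePath k t ℓ))
  map_one' := by simpa using h.linVal_one
  map_mul' x y := by
    simpa using h.linVal_apply_eq x (y.1 (onePath k t ℓ))
  map_zero' := by simp
  map_add' x y := by simp
  commutes' r := by
    have := h.linVal_one (k := k)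
    simp [Algebra.algebraMap_eq_smul_one, this]

lemma IsRep.lift_apply (h : IsRep e α) (x : PathAlg k t ℓ) :
    h.lift x = ∑ p, x.1 (onePath k t ℓ) p • pathVal e α p := rfl

lemma IsRep.lift_eV (h : IsRep e α) (v : Vtx t ℓ) : h.lift (eV (k := k) v) = e v := by
  change linVal k e α (Ev k v (onePath k t ℓ)) = _
  rw [h.linVal_Ev, h.linVal_one, mul_one]

lemma IsRep.lift_arE (h : IsRep e α) (i : Fin t) (j : ℕ) :
    h.lift (arE (k := k) (ℓ := ℓ) i j) = α i j := by
  change linVal k e α (Ar k i j (onePath k t ℓ)) = _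
  rw [h.linVal_Ar, h.linVal_one, mul_one]

lemma subE_eq (i : Fin t) (a b : ℕ) :
    (subE i a b : PathAlg k t ℓ) = icoProd (arE i) a b := rfl

lemma IsRep.lift_subE (h : IsRep e α) (i : Fin t) (a b : ℕ) :
    h.lift (subE (k := k) (ℓ := ℓ) i a b) = icoProd (α i) a b := by
  simp only [subE, icoProd, map_list_prod, List.map_map]
  congr 2
  funext s
  exact h.lift_arE i (a + s)

lemma isRep_self : IsRep (eV (k := k) (t := t) (ℓ := ℓ)) (fun i j => arE i j) where
  idem v := by
    refine Subtype.ext (LinearMap.ext fun f => funext fun p => ?_)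
    change (if _ then (if _ then _ else _) else _) = if _ then _ else _
    split_ifs <;> rfl
  orth v w hvw := by
    refine Subtype.ext (LinearMap.ext fun f => funext fun p => ?_)
    change (if _ then (if _ then _ else _) else _) = (0 : k)
    split_ifs <;> simp_all
  sum := by
    refine Subtype.ext (LinearMap.ext fun f => funext fun p => ?_)
    simp [eV, Ev, LinearMap.sum_apply]
  left i j hj := by
    refine Subtype.ext (LinearMap.ext fun f => funext fun p => ?_)
    change (if _ then (strip i j p).elim 0 f else 0) = (strip i j p).elim 0 f
    split_ifs with hp
    · rfl
    · rcases hs : strip i j p with _ | q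
      · rfl
      · obtain ⟨b, hab, hb, rfl, _⟩ := strip_eq_some hs
        exact absurd rfl hp
  right i j hj := by
    refine Subtype.ext (LinearMap.ext fun f => funext fun p => ?_)
    change (strip i j p).elim 0 (fun q => if startIdx q = vtx t ℓ i (j + 1) then f q else 0) =
      (strip i j p).elim 0 f
    rcases hs : strip i j p with _ | q
    · rfl
    · obtain ⟨b, hab, hb, rfl, ⟨rfl, rfl⟩ | ⟨_, rfl⟩⟩ := strip_eq_some hs
      · simp [startIdx]
      · simp [startIdx]
  junk i j hj := by
    refine Subtype.ext (LinearMap.ext fun f => funext fun p => ?_)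
    change (strip i j p).elim 0 f = 0
    rcases hs : strip i j p with _ | q
    · rfl
    · obtain ⟨b, hab, hb, rfl, _⟩ := strip_eq_some hs
      omega

/-- A path as an element of the path algebra. -/
abbrev pathE (p : PIdx t ℓ) : PathAlg k t ℓ := pathVal eV (fun i j => arE i j) p

lemma lift_self : (isRep_self (k := k) (t := t) (ℓ := ℓ)).lift = AlgHom.id k (PathAlg k t ℓ) := by
  refine AlgHom.ext fun x => ?_
  obtain ⟨x, hx⟩ := x
  induction hx using Algebra.adjoin_induction with
  | mem x hx =>
    rcases hx with ⟨v, rfl⟩ | ⟨i, j, rfl⟩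
    · exact isRep_self.lift_eV v
    · exact isRep_self.lift_arE i j
  | algebraMap r => exact AlgHomClass.commutes (isRep_self.lift) r
  | add x y hx hy hx' hy' =>
    exact (map_add isRep_self.lift ⟨x, hx⟩ ⟨y, hy⟩).trans (congrArg₂ (· + ·) hx' hy')
  | mul x y hx hy hx' hy' =>
    exact (map_mul isRep_self.lift ⟨x, hx⟩ ⟨y, hy⟩).trans (congrArg₂ (· * ·) hx' hy')

lemma eq_sum_pathE (x : PathAlg k t ℓ) : x = ∑ p, x.1 (onePath k t ℓ) p • pathE p := by
  rw [← isRep_self.lift_apply, lift_self]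
  rfl

end Representations

section Coefficients

variable {k : Type u} [Field k] {t : ℕ} {ℓ : Fin t → ℕ}

/-- The coefficient of a path in an element of the path algebra. -/
def coef (p : PIdx t ℓ) : PathAlg k t ℓ →ₗ[k] k where
  toFun x := x.1 (onePath k t ℓ) p
  map_add' x y := by simp
  map_smul' c x := by simp

lemma eq_sum_coef (x : PathAlg k t ℓ) : x = ∑ p, coef p x • pathE p := eq_sum_pathE x

lemma Ar_single {i : Fin t} {j : ℕ} {p q : PIdx t ℓ} (h : strip i j p = some q) :
    Ar k i j (Pi.single q 1) = Pi.single p 1 := by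
  funext p'
  change (strip i j p').elim 0 (Pi.single q 1) = _
  by_cases hp : p' = p
  · subst hp
    simp [h]
  · rw [Pi.single_eq_of_ne hp]
    rcases hs : strip i j p' with _ | q'
    · rfl
    · have : q' ≠ q := by
        rintro rfl
        exact hp (strip_injective hs h)
      simp [Pi.single_eq_of_ne this]

lemma pathE_strip {i : Fin t} {j : ℕ} {p q : PIdx t ℓ} (h : strip i j p = some q) :
    (pathE p : PathAlg k t ℓ) = arE i j * pathE q := isRep_self.pathVal_strip h

lemma pathE_apply_onePath (p : PIdx t ℓ) :
    (pathE p : PathAlg k t ℓ).1 (onePath k t ℓ) = Pi.single p 1 := by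
  have hv : ∀ v : Vtx t ℓ, (pathE (.vert v) : PathAlg k t ℓ).1 (onePath k t ℓ) =
      Pi.single (.vert v) 1 := by
    intro v
    funext q
    change (if startIdx q = v then onePath k t ℓ q else 0) = _
    cases q with
    | vert w =>
      by_cases h : w = v
      · subst h
        simp [startIdx, onePath]
      · simp [startIdx, h]
    | sub => simp [onePath]
  cases p with
  | vert v => exact hv v
  | sub i a b hab hb =>
    obtain ⟨n, rfl⟩ : ∃ n, b = a + 1 + n := ⟨b - (a + 1), by omega⟩
    induction n generalizing a with
    | zero =>
      have hs : strip i a (.sub i a (a + 1 + 0) hab hb : PIdx t ℓ) =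
          some (.vert (vtx t ℓ i (a + 1))) := by simp [strip]
      rw [pathE_strip hs]
      change Ar k i a ((pathE (.vert (vtx t ℓ i (a + 1))) : PathAlg k t ℓ).1 _) = _
      rw [hv, Ar_single hs]
    | succ n ih =>
      have hs : strip i a (.sub i a (a + 1 + (n + 1)) hab hb : PIdx t ℓ) =
          some (.sub i (a + 1) (a + 1 + (n + 1)) (by omega) hb) := by simp [strip]
      rw [pathE_strip hs]
      have h2 := ih (a + 1) (by omega) (by omega)
      simp only [show a + 1 + 1 + n = a + 1 + (n + 1) by omega] at h2
      change Ar k i a ((pathE (.sub i (a + 1) (a + 1 + (n + 1)) _ hb) : PathAlg k t ℓ).1 _) = _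
      rw [h2, Ar_single hs]

lemma coef_pathE (p q : PIdx t ℓ) : coef p (pathE q : PathAlg k t ℓ) = if p = q then 1 else 0 := by
  change (pathE q : PathAlg k t ℓ).1 (onePath k t ℓ) p = _
  rw [pathE_apply_onePath, Pi.single_apply]

lemma pathE_sub {i : Fin t} {a b : ℕ} (hab : a < b) (hb : b ≤ ℓ i) :
    (pathE (.sub i a b hab hb) : PathAlg k t ℓ) = subE i a b := rfl

lemma startIdx_eq_vtx {p : PIdx t ℓ} {i : Fin t} {a : ℕ} (h : startIdx p = vtx t ℓ i a)
    (ha : 0 < a) : p = .vert (vtx t ℓ i a) ∨ ∃ b hab hb, p = .sub i a b hab hb := by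
  cases p with
  | vert v => exact Or.inl (congrArg _ h)
  | sub i' a' b hab hb =>
    right
    change vtx t ℓ i' a' = _ at h
    rcases lt_or_ge a (ℓ i) with h1 | h1
    · obtain ⟨rfl, rfl⟩ := vtx_injective_left h.symm ha h1
      exact ⟨b, hab, hb, rfl⟩
    · rw [vtx_of_le ha h1] at h
      rcases Nat.eq_zero_or_pos a' with rfl | h0
      · rw [vtx_zero] at h; cases h
      · rw [vtx_mid h0 (by omega)] at h; cases h

/-- The paths from the source to the sink. -/
def IsFull (p : PIdx t ℓ) : Prop := startIdx p = .src ∧ endIdx p = .snk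

lemma IsFull.exists_eq {p : PIdx t ℓ} (h : IsFull p) :
    ∃ i, ∃ h : 0 < ℓ i, p = .sub i 0 (ℓ i) h le_rfl := by
  obtain ⟨h1, h2⟩ := h
  cases p with
  | vert v =>
    change v = _ at h1
    change v = _ at h2
    subst h1
    cases h2
  | sub i a b hab hb =>
    change vtx t ℓ i a = _ at h1
    change vtx t ℓ i b = _ at h2
    have ha : a = 0 := by
      by_contra ha
      rw [vtx_mid (by omega) (by omega)] at h1
      cases h1
    have hb' : b = ℓ i := by
      by_contra hb'
      rw [vtx_mid (by omega) (by omega)] at h2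
      cases h2
    subst ha hb'
    exact ⟨i, hab, rfl⟩

lemma vtx_ne_src {i : Fin t} {a : ℕ} (h : 0 < a) : vtx t ℓ i a ≠ .src := by
  intro h'
  rcases lt_or_ge a (ℓ i) with h1 | h1
  · rw [vtx_mid h h1] at h'; cases h'
  · rw [vtx_of_le h h1] at h'; cases h'

lemma path_ext {p q : PIdx t ℓ} (h1 : startIdx p = startIdx q) (h2 : endIdx p = endIdx q)
    (hp : ¬ IsFull p) : p = q := by
  have key : ∀ {i i' : Fin t} {a b a' b' : ℕ} (hab : a < b) (hb : b ≤ ℓ i) (hab' : a' < b')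
      (hb' : b' ≤ ℓ i'), vtx t ℓ i a = vtx t ℓ i' a' → vtx t ℓ i b = vtx t ℓ i' b' →
      ¬ IsFull (.sub i a b hab hb) →
      (.sub i a b hab hb : PIdx t ℓ) = .sub i' a' b' hab' hb' := by
    intro i i' a b a' b' hab hb hab' hb' h1 h2 hp
    have hi : i = i' := by
      by_cases ha : 0 < a
      · exact (vtx_injective_left h1 ha (by omega)).1
      · by_cases hbb : b < ℓ i
        · exact (vtx_injective_left h2 (by omega) hbb).1
        · refine absurd ⟨?_, ?_⟩ hp
          · obtain rfl : a = 0 := by omega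
            exact vtx_zero i
          · exact vtx_of_le (by omega) (by omega)
    subst hi
    obtain rfl := vtx_injective h1 (by omega) (by omega)
    obtain rfl := vtx_injective h2 (by omega) (by omega)
    rfl
  have loop : ∀ {i : Fin t} {a b : ℕ}, a < b → b ≤ ℓ i → vtx t ℓ i a ≠ vtx t ℓ i b := by
    intro i a b hab hb h
    have := vtx_injective h (by omega) hb
    omega
  cases p with
  | vert v =>
    cases q with
    | vert w => exact congrArg _ h1
    | sub i a b hab hb => exact absurd (h1.symm.trans h2) (loop hab hb)
  | sub i a b hab hb =>
    cases q with
    | vert w => exact absurd (h1.trans h2.symm) (loop hab hb)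
    | sub i' a' b' hab' hb' => exact key hab hb hab' hb' h1 h2 hp

lemma eV_mul_mul_eV (v w : Vtx t ℓ) (x : PathAlg k t ℓ) :
    eV v * x * eV w =
      ∑ p, if startIdx p = v ∧ endIdx p = w then coef p x • pathE p else 0 := by
  conv_lhs => rw [eq_sum_coef x]
  simp only [Finset.mul_sum, Finset.sum_mul, mul_smul_comm, smul_mul_assoc]
  refine Finset.sum_congr rfl fun p _ => ?_
  rw [isRep_self.vert_mul]
  by_cases h1 : startIdx p = v
  · rw [if_pos h1, isRep_self.mul_vert]
    by_cases h2 : endIdx p = w <;> simp [h1, h2]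
  · simp [h1]

lemma eV_mul_mul_eV_of_not_isFull {p : PIdx t ℓ} (hp : ¬ IsFull p) (x : PathAlg k t ℓ) :
    eV (startIdx p) * x * eV (endIdx p) = coef p x • pathE p := by
  rw [eV_mul_mul_eV, Finset.sum_eq_single p]
  · simp
  · intro q _ hq
    rw [if_neg]
    rintro ⟨h1, h2⟩
    exact hq (path_ext h1.symm h2.symm hp).symm
  · simp

lemma eV_mul_eq_sum (v : Vtx t ℓ) (x : PathAlg k t ℓ) :
    eV v * x = ∑ p, if startIdx p = v then coef p x • pathE p else 0 := by
  conv_lhs => rw [eq_sum_coef x]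
  simp only [Finset.mul_sum, mul_smul_comm]
  refine Finset.sum_congr rfl fun p _ => ?_
  rw [isRep_self.vert_mul]
  split_ifs <;> simp

lemma not_isFull_vert (v : Vtx t ℓ) : ¬ IsFull (.vert v) := by
  rintro ⟨h1, h2⟩
  cases h1.symm.trans h2

lemma eV_mul_mul_eV_self (v : Vtx t ℓ) (x : PathAlg k t ℓ) :
    eV v * x * eV v = coef (.vert v) x • eV v :=
  eV_mul_mul_eV_of_not_isFull (not_isFull_vert v) x

end Coefficients

section Ideal

variable {k : Type u} [Field k] (T : ToupieAlg k)

lemma smul_mem_I (c : k) {x : PathAlg k T.t T.ℓ} (h : x ∈ T.I) : c • x ∈ T.I := by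
  rw [Algebra.smul_def]
  exact T.I.mul_mem_left _ _ h

lemma mem_I_of_smul {c : k} (hc : c ≠ 0) {x : PathAlg k T.t T.ℓ} (h : c • x ∈ T.I) :
    x ∈ T.I := by
  simpa [smul_smul, hc] using smul_mem_I T c⁻¹ h

lemma sum_mem_I {ι : Type*} (s : Finset ι) {f : ι → PathAlg k T.t T.ℓ}
    (h : ∀ i ∈ s, f i ∈ T.I) : ∑ i ∈ s, f i ∈ T.I := by
  induction s using Finset.induction_on with
  | empty => simp
  | insert a s ha ih =>
    rw [Finset.sum_insert ha]
    exact T.I.add_mem (h _ (by simp)) (ih fun i hi => h i (by simp [hi]))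

lemma mkA_eq_zero_iff {x : PathAlg k T.t T.ℓ} : mkA T x = 0 ↔ x ∈ T.I := by
  rw [TwoSidedIdeal.mem_iff]
  exact RingCon.eq T.I.ringCon (a := x) (b := 0)

lemma mkA_smul (c : k) (x : PathAlg k T.t T.ℓ) : mkA T (c • x) = c • mkA T x := by
  rw [Algebra.smul_def, Algebra.smul_def, map_mul]
  rfl

lemma coef_eq_zero_of_mem {x : PathAlg k T.t T.ℓ} (hx : x ∈ T.I) {p : PIdx T.t T.ℓ}
    (hp : ∀ i a b hab hb, p = .sub i a b hab hb → b < a + 2) : coef p x = 0 := by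
  have hle : Submodule.span k {y : PathAlg k T.t T.ℓ |
      ∃ i a b, a + 2 ≤ b ∧ b ≤ T.ℓ i ∧ y = subE i a b} ≤ LinearMap.ker (coef p) := by
    rw [Submodule.span_le]
    rintro _ ⟨i, a, b, hab, hb, rfl⟩
    rw [SetLike.mem_coe, LinearMap.mem_ker, ← pathE_sub (by omega) hb, coef_pathE, if_neg]
    intro h
    have := hp _ _ _ _ _ h
    omega
  exact hle (T.adm x hx)

lemma eV_notMem (v : Vtx T.t T.ℓ) : eV v ∉ T.I := by
  intro h
  have h1 := coef_eq_zero_of_mem T h (p := .vert v) (by simp)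
  rw [show (eV v : PathAlg k T.t T.ℓ) = pathE (.vert v) from rfl, coef_pathE] at h1
  simp at h1

lemma subE_succ_notMem {i : Fin T.t} {a b : ℕ} (hb : b < a + 2) (hab : a < b) (h : b ≤ T.ℓ i) :
    subE i a b ∉ T.I := by
  intro hm
  rw [← pathE_sub hab h] at hm
  have h1 := coef_eq_zero_of_mem T hm (p := .sub i a b hab h) (by
    intro i' a' b' _ _ heq
    simp only [PIdx.sub.injEq] at heq
    omega)
  rw [coef_pathE] at h1
  simp at h1

lemma arE_notMem {i : Fin T.t} {a : ℕ} (h : a < T.ℓ i) : arE i a ∉ T.I := by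
  have := subE_succ_notMem T (i := i) (a := a) (b := a + 1) (by omega) (by omega) (by omega)
  rwa [subE_eq, icoProd_succ] at this

lemma subE_mul_subE (i : Fin T.t) {a b c : ℕ} (hab : a ≤ b) (hbc : b ≤ c) :
    (subE i a b * subE i b c : PathAlg k T.t T.ℓ) = subE i a c :=
  (congrArg₂ (· * ·) (subE_eq i a b) (subE_eq i b c)).trans
    ((icoProd_mul (arE i) hab hbc).trans (subE_eq i a c).symm)

lemma pathE_mem_of_coef_ne_zero {x : PathAlg k T.t T.ℓ} (hx : x ∈ T.I) {p : PIdx T.t T.ℓ}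
    (hp : ¬ IsFull p) (hc : coef p x ≠ 0) : pathE p ∈ T.I := by
  refine mem_I_of_smul T hc ?_
  rw [← eV_mul_mul_eV_of_not_isFull hp]
  exact T.I.mul_mem_right _ _ (T.I.mul_mem_left _ _ hx)

lemma sum_isFull_mem {x : PathAlg k T.t T.ℓ} (hx : x ∈ T.I) :
    ∑ p, (if IsFull p then coef p x • pathE p else 0) ∈ T.I := by
  have h1 := T.I.mul_mem_right _ (eV Vtx.snk) (T.I.mul_mem_left (eV Vtx.src) _ hx)
  rw [eV_mul_mul_eV] at h1
  convert h1 using 3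
  exact Iff.rfl

/-- If `e₀ A e∞` is one-dimensional, every branch is a scalar multiple of a fixed branch
modulo the ideal. -/
lemma exists_branch_of_mDim (hm : mDim T = 1) :
    ∃ c : Fin T.t, wE c ∉ T.I ∧ ∃ Λ : Fin T.t → k, ∀ i, mkA T (wE i) = Λ i • mkA T (wE c) := by
  have hw : ∀ i, mkA T (wE i) ∈ LinearMap.range (lrMap T) := by
    intro i
    refine ⟨mkA T (wE i), ?_⟩
    change mkA T (eV Vtx.src) * mkA T (wE i) * mkA T (eV Vtx.snk) = _
    rw [← map_mul, ← map_mul]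
    congr 1
    have hp : (wE i : PathAlg k T.t T.ℓ) = pathE (.sub i 0 (T.ℓ i) (T.hℓ i) le_rfl) := rfl
    have h1 := isRep_self.start_mul (.sub i 0 (T.ℓ i) (T.hℓ i) le_rfl) (e := eV (k := k))
    have h2 := isRep_self.mul_end (.sub i 0 (T.ℓ i) (T.hℓ i) le_rfl) (e := eV (k := k))
    simp only [startIdx, endIdx, vtx_zero, vtx_of_le (T.hℓ i) le_rfl] at h1 h2
    rw [hp]
    exact (congrArg (· * eV Vtx.snk) h1).trans h2
  have hc : ∃ c, wE c ∉ T.I := by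
    by_contra! hall
    have h0 : lrMap T = 0 := by
      ext x
      obtain ⟨x, rfl⟩ := mkA_surjective T x
      change mkA T (eV Vtx.src) * mkA T x * mkA T (eV Vtx.snk) = 0
      rw [← map_mul, ← map_mul, mkA_eq_zero_iff, eV_mul_mul_eV]
      refine sum_mem_I T _ fun p _ => ?_
      split_ifs with hp
      · obtain ⟨i, hi, rfl⟩ := IsFull.exists_eq hp
        exact smul_mem_I T _ (hall i)
      · exact T.I.zero_mem
    rw [mDim, h0, LinearMap.range_zero, finrank_bot] at hm
    exact absurd hm (by norm_num)
  obtain ⟨c, hc⟩ := hc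
  refine ⟨c, hc, ?_⟩
  have hne : (⟨mkA T (wE c), hw c⟩ : LinearMap.range (lrMap T)) ≠ 0 := by
    intro h
    exact hc ((mkA_eq_zero_iff T).1 (congrArg Subtype.val h))
  have h1 := (finrank_eq_one_iff_of_nonzero' _ hne).1 hm
  choose Λ hΛ using fun i => h1 ⟨mkA T (wE i), hw i⟩
  refine ⟨Λ, fun i => ?_⟩
  exact (congrArg Subtype.val (hΛ i)).symm

/-- A criterion for a representation of the quiver to satisfy the relations in the ideal. -/
lemma IsRep.lift_eq_zero {B : Type*} [Ring B] [Algebra k B] {e : Vtx T.t T.ℓ → B}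
    {α : Fin T.t → ℕ → B} (h : IsRep e α) {c : Fin T.t} (hc : wE c ∉ T.I) {Λ : Fin T.t → k}
    (hΛ : ∀ i, mkA T (wE i) = Λ i • mkA T (wE c))
    (hα : ∀ i a b, a + 2 ≤ b → b ≤ T.ℓ i → subE i a b ∈ T.I → icoProd (α i) a b = 0)
    (hw : ∀ i, icoProd (α i) 0 (T.ℓ i) = Λ i • icoProd (α c) 0 (T.ℓ c))
    {x : PathAlg k T.t T.ℓ} (hx : x ∈ T.I) : h.lift x = 0 := by
  let μ : PIdx T.t T.ℓ → k := fun p =>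
    match p with
    | .vert _ => 0
    | .sub i _ _ _ _ => Λ i
  have hfull : ∑ p, (if IsFull p then coef p x * μ p else 0) = 0 := by
    by_contra hne
    refine hc (mem_I_of_smul T hne ?_)
    rw [← mkA_eq_zero_iff, mkA_smul, Finset.sum_smul,
      ← (mkA_eq_zero_iff T).2 (sum_isFull_mem T hx), map_sum]
    refine Finset.sum_congr rfl fun p _ => ?_
    split_ifs with hp
    · obtain ⟨i, hi, rfl⟩ := IsFull.exists_eq hp
      rw [mkA_smul, mul_smul]
      exact congrArg _ (hΛ i).symm
    · rw [zero_smul, map_zero]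
  rw [h.lift_apply]
  have h4 : ∀ p, x.1 (onePath k T.t T.ℓ) p • pathVal e α p =
      (if IsFull p then coef p x * μ p else 0) • icoProd (α c) 0 (T.ℓ c) := by
    intro p
    change coef p x • _ = _
    split_ifs with hp
    · obtain ⟨i, hi, rfl⟩ := IsFull.exists_eq hp
      simp only [pathVal, μ]
      rw [hw i, mul_smul]
    · rw [zero_smul]
      by_cases hcp : coef p x = 0
      · rw [hcp, zero_smul]
      have hmem := pathE_mem_of_coef_ne_zero T hx hp hcp
      cases p with
      | vert v => exact absurd hmem (eV_notMem T v)
      | sub i a b hab hb =>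
        rcases lt_or_ge b (a + 2) with h2 | h2
        · exact absurd hmem (subE_succ_notMem T h2 hab hb)
        · simp only [pathVal]
          rw [hα i a b h2 hb hmem, smul_zero]
  simp only [h4, ← Finset.sum_smul, hfull, zero_smul]

/-- If a nonzero path from an inner position `a` on a branch is killed by the next arrow, and
`u` is a path ending at `a`, then `u` is not divisible by itself modulo annihilation. -/
lemma mem_of_mul_sub_mem {i : Fin T.t} {b : ℕ} (hb : b < T.ℓ i)
    {u z : PathAlg k T.t T.ℓ} (hu : u * eV (vtx T.t T.ℓ i b) = u)
    (hz : z * arE i b ∈ T.I) (huz : mkA T (u * z) = mkA T u) : u ∈ T.I := by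
  set v := vtx T.t T.ℓ i b
  have h1 : eV v * z * eV v = coef (.vert v) z • eV v := eV_mul_mul_eV_self v z
  have h2 : coef (.vert v) z = 0 := by
    by_contra hne
    refine arE_notMem T hb (mem_I_of_smul T hne ?_)
    have h3 : eV v * (z * arE i b) ∈ T.I := T.I.mul_mem_left _ _ hz
    rw [← isRep_self.left i b hb, ← mul_assoc, ← mul_assoc, h1, smul_mul_assoc,
      isRep_self.left i b hb] at h3
    exact h3
  have h5 : u * z * eV v = u * (eV v * z * eV v) := by
    rw [← mul_assoc, ← mul_assoc, hu]
  rw [← mkA_eq_zero_iff, ← hu, map_mul, ← huz, ← map_mul, h5, h1, h2, zero_smul, mul_zero,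
    map_zero]

lemma mul_mul_eV_endIdx {i : Fin T.t} {a : ℕ} {p : PIdx T.t T.ℓ}
    (hp : startIdx p = vtx T.t T.ℓ i (a + 1)) (x : PathAlg k T.t T.ℓ) {u : PathAlg k T.t T.ℓ}
    (hu : u * eV (vtx T.t T.ℓ i (a + 1)) = u) :
    u * x * eV (endIdx p) = coef p x • (u * pathE p) := by
  have hnf : ¬ IsFull p := fun h => vtx_ne_src (Nat.succ_pos a) (hp ▸ h.1)
  rw [← mul_smul_comm, ← eV_mul_mul_eV_of_not_isFull hnf, hp, ← mul_assoc, ← mul_assoc, hu]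

/-- The annihilator of an arrow ending at an inner vertex, when `subE i a b` is the shortest
zero path starting with that arrow. -/
lemma exists_of_arE_mul_mem {i : Fin T.t} {a b : ℕ} (hab : a + 2 ≤ b) (hb : b ≤ T.ℓ i)
    (hmin : ∀ c, a < c → c < b → subE i a c ∉ T.I) {x : PathAlg k T.t T.ℓ}
    (hx : arE i a * x ∈ T.I) :
    ∃ y, mkA T (eV (vtx T.t T.ℓ i (a + 1)) * x) = mkA T (subE i (a + 1) b * y) := by
  have key : ∀ p : PIdx T.t T.ℓ, ∃ y,
      mkA T (if startIdx p = vtx T.t T.ℓ i (a + 1) then coef p x • pathE p else 0) =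
        mkA T (subE i (a + 1) b * y) := by
    intro p
    split_ifs with hp
    · by_cases hc : coef p x = 0
      · exact ⟨0, by simp [hc]⟩
      have h1 := T.I.mul_mem_right _ (eV (endIdx p)) hx
      rw [mul_mul_eV_endIdx T hp x (isRep_self.right i a (by omega))] at h1
      have h2 := mem_I_of_smul T hc h1
      rcases startIdx_eq_vtx hp (Nat.succ_pos a) with rfl | ⟨d, had, hd, rfl⟩
      · have h3 : arE i a * eV (vtx T.t T.ℓ i (a + 1)) ∈ T.I := h2
        rw [isRep_self.right i a (by omega)] at h3
        exact absurd h3 (arE_notMem T (by omega))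
      · have h3 : arE i a * subE i (a + 1) d ∈ T.I := h2
        rw [subE_eq, ← icoProd_cons (fun j => arE i j) (by omega)] at h3
        have hbd : b ≤ d := by
          by_contra hlt
          exact hmin d (by omega) (by omega) h3
        refine ⟨coef (.sub i (a + 1) d had hd) x • subE i b d, ?_⟩
        rw [mul_smul_comm, subE_mul_subE T i (by omega) hbd]
        rfl
    · exact ⟨0, by simp⟩
  choose y hy using key
  refine ⟨∑ p, y p, ?_⟩
  rw [eV_mul_eq_sum, Finset.mul_sum, map_sum, map_sum]
  exact Finset.sum_congr rfl fun p _ => hy p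

lemma eV_mul_eq_zero_of_subE_mul_mem {i : Fin T.t} {a b : ℕ} (hab : a < b)
    (hb : b ≤ T.ℓ i) (hnz : subE i a (T.ℓ i) ∉ T.I) {x : PathAlg k T.t T.ℓ}
    (hx : subE i a b * x ∈ T.I) : eV (vtx T.t T.ℓ i b) * x = 0 := by
  rw [eV_mul_eq_sum]
  refine Finset.sum_eq_zero fun p _ => ?_
  split_ifs with hp
  · by_cases hc : coef p x = 0
    · rw [hc, zero_smul]
    exfalso
    obtain ⟨d, rfl⟩ : ∃ d, b = d + 1 := ⟨b - 1, by omega⟩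
    have h1 := T.I.mul_mem_right _ (eV (endIdx p)) hx
    have hue : subE i a (d + 1) * eV (vtx T.t T.ℓ i (d + 1)) = (subE i a (d + 1) : PathAlg k _ _) :=
      isRep_self.mul_end (.sub i a (d + 1) hab hb) (e := eV (k := k))
    rw [mul_mul_eV_endIdx T hp x hue] at h1
    have h2 := mem_I_of_smul T hc h1
    rcases startIdx_eq_vtx hp (Nat.succ_pos d) with rfl | ⟨f, hdf, hf, rfl⟩
    · have h3 : subE i a (d + 1) * eV (vtx T.t T.ℓ i (d + 1)) ∈ T.I := h2
      rw [hue] at h3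
      refine hnz ?_
      rw [← subE_mul_subE T i hab.le hb]
      exact T.I.mul_mem_right _ _ h3
    · have h3 : subE i a (d + 1) * subE i (d + 1) f ∈ T.I := h2
      rw [subE_mul_subE T i hab.le hdf.le] at h3
      refine hnz ?_
      rw [← subE_mul_subE T i (show a ≤ f by omega) hf]
      exact T.I.mul_mem_right _ _ h3
  · rfl

end Ideal

section Homological

variable {R : Type u} [Ring R]

/-- Schanuel's lemma for a cyclic module of projective dimension at most one. -/
lemma projective_of_pdLeOne {L : Submodule R R} (h : PdLeOne R (ModuleCat.of R (R ⧸ L))) :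
    Module.Projective R L := by
  obtain ⟨P, f, hf, hP, hK⟩ := h
  change P →ₗ[R] R ⧸ L at f
  obtain ⟨g, hg⟩ := Module.projective_lifting_property f L.mkQ hf
  replace hg : ∀ r, f (g r) = L.mkQ r := fun r => LinearMap.congr_fun hg r
  let F : (LinearMap.ker f × R) →ₗ[R] P := (LinearMap.ker f).subtype.coprod g
  have hF : Function.Surjective F := by
    intro p
    obtain ⟨r, hr⟩ := L.mkQ_surjective (f p)
    refine ⟨(⟨p - g r, ?_⟩, r), ?_⟩
    · rw [LinearMap.mem_ker, map_sub, hg, hr, sub_self]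
    · simp [F]
  obtain ⟨s, hs⟩ := Module.projective_lifting_property F LinearMap.id hF
  have hs' : ∀ p, F (s p) = p := fun p => LinearMap.congr_fun hs p
  let G : (LinearMap.ker f × R) →ₗ[R] R := LinearMap.snd R _ _ ∘ₗ (LinearMap.id - s ∘ₗ F)
  have hG : ∀ x, G x ∈ L := by
    intro x
    have h1 : F (x - s (F x)) = 0 := by rw [map_sub, hs', sub_self]
    have h2 : f (F (x - s (F x))) = L.mkQ (x - s (F x)).2 := by
      simp only [F, LinearMap.coprod_apply, map_add, hg]
      simp
    rw [h1, map_zero] at h2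
    exact (Submodule.Quotient.mk_eq_zero L).1 h2.symm
  let j : L →ₗ[R] (LinearMap.ker f × R) :=
    ((-g ∘ₗ L.subtype).codRestrict (LinearMap.ker f) (fun x => by
      rw [LinearMap.mem_ker]
      simp only [LinearMap.neg_apply, LinearMap.comp_apply, map_neg, hg, neg_eq_zero]
      exact (Submodule.Quotient.mk_eq_zero L).2 x.2)).prod L.subtype
  refine Module.Projective.of_split j (G.codRestrict L hG) ?_
  refine LinearMap.ext fun x => Subtype.ext ?_
  have hFj : F (j x) = 0 := by simp [F, j]
  change (j x - s (F (j x))).2 = x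
  rw [hFj, map_zero, sub_zero]
  rfl

lemma exists_of_pdLeOne {e u : R} (he : e * e = e) (hu : u * e = u)
    (h : PdLeOne R (ModuleCat.of R (R ⧸ Submodule.span R {1 - e, u}))) :
    ∃ z, z * u = u ∧ ∀ r, r * u = 0 → r * z = 0 := by
  have hL := projective_of_pdLeOne h
  set L := Submodule.span R {1 - e, u}
  let U := Submodule.span R {u}
  have hUe : ∀ x ∈ U, x * e = x := by
    intro x hx
    obtain ⟨r, rfl⟩ := Submodule.mem_span_singleton.1 hx
    rw [smul_eq_mul, mul_assoc, hu]
  have hUL : U ≤ L := Submodule.span_mono (by simp)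
  let ρ : L →ₗ[R] U := ((LinearMap.toSpanSingleton R R e).domRestrict L).codRestrict U (by
    rintro ⟨x, hx⟩
    change x * e ∈ U
    induction hx using Submodule.span_induction with
    | mem x hx =>
      rcases hx with rfl | rfl
      · rw [sub_mul, one_mul, he, sub_self]
        exact U.zero_mem
      · rw [hu]
        exact Submodule.mem_span_singleton_self x
    | zero => rw [zero_mul]; exact U.zero_mem
    | add x y _ _ hx hy => rw [add_mul]; exact U.add_mem hx hy
    | smul r x _ hx => rw [smul_eq_mul, mul_assoc]; exact U.smul_mem r hx)
  have hU : Module.Projective R U := by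
    refine Module.Projective.of_split (Submodule.inclusion hUL) ρ ?_
    refine LinearMap.ext fun x => Subtype.ext ?_
    exact hUe x x.2
  let u' : U := ⟨u, Submodule.mem_span_singleton_self u⟩
  have hsurj : Function.Surjective (LinearMap.toSpanSingleton R U u') := by
    rintro ⟨x, hx⟩
    obtain ⟨r, rfl⟩ := Submodule.mem_span_singleton.1 hx
    exact ⟨r, rfl⟩
  obtain ⟨s, hs⟩ := Module.projective_lifting_property _ LinearMap.id hsurj
  refine ⟨s u', ?_, ?_⟩
  · exact congrArg Subtype.val (LinearMap.congr_fun hs u')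
  · intro r hr
    have h1 : r • u' = 0 := Subtype.ext hr
    rw [← smul_eq_mul, ← map_smul, h1, map_zero]

lemma exists_smul_eq_of_injective {E : Type u} [AddCommGroup E] [Module R E]
    (hE : Module.Injective R E) {a : R} {p : E} (h : ∀ r, r * a = 0 → r • p = 0) :
    ∃ q, a • q = p := by
  let F := LinearMap.toSpanSingleton R R a
  let f : (R ⧸ LinearMap.ker F) →ₗ[R] R := (LinearMap.ker F).liftQ F le_rfl
  have hf : Function.Injective f :=
    LinearMap.ker_eq_bot.1 ((LinearMap.ker F).ker_liftQ_eq_bot F le_rfl le_rfl)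
  let g : (R ⧸ LinearMap.ker F) →ₗ[R] E :=
    (LinearMap.ker F).liftQ (LinearMap.toSpanSingleton R E p) (fun r hr => h r hr)
  obtain ⟨φ, hφ⟩ := hE.out f hf g
  refine ⟨φ 1, ?_⟩
  have h1 := hφ (Submodule.Quotient.mk 1)
  have h2 : f (Submodule.Quotient.mk 1) = a • (1 : R) := by
    change (1 : R) • a = a • 1
    simp
  have h3 : g (Submodule.Quotient.mk 1) = p := one_smul R p
  rw [h2, h3, map_smul] at h1
  exact h1

/-- A criterion for a module to have injective dimension greater than one. -/
lemma not_idLeOne {M : ModuleCat.{u} R} {α v e f : R} (hvα : v * α = 0) (he : e * e = e)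
    (hve : v * e = v) (hα : ∀ r, r * α = 0 → ∃ s, r * e = s * v)
    (hv : ∀ r, r * v = 0 → r * f = 0) {y : M} (hfy : f • y = y) (hy : ∀ m : M, y ≠ v • m) :
    ¬ IdLeOne R M := by
  rintro ⟨E, ι, hι, hE, hE'⟩
  obtain ⟨p', hp'⟩ := exists_smul_eq_of_injective hE (a := v) (p := ι y) (by
    intro r hr
    rw [← hfy, map_smul, smul_smul, hv r hr, zero_smul])
  obtain ⟨p, hvp, hep⟩ : ∃ p, v • p = ι y ∧ e • p = p :=
    ⟨e • p', by rw [smul_smul, hve, hp'], by rw [smul_smul, he]⟩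
  obtain ⟨q', hq'⟩ := exists_smul_eq_of_injective hE' (a := α)
    (p := Submodule.Quotient.mk p) (by
      intro r hr
      obtain ⟨s, hs⟩ := hα r hr
      rw [← Submodule.Quotient.mk_smul, ← hep, smul_smul, hs, ← smul_smul, hvp, ← map_smul,
        Submodule.Quotient.mk_eq_zero]
      exact LinearMap.mem_range_self _ _)
  obtain ⟨q, rfl⟩ := Submodule.Quotient.mk_surjective _ q'
  rw [← Submodule.Quotient.mk_smul, Submodule.Quotient.eq] at hq'
  obtain ⟨m, hm⟩ := hq'
  refine hy (-m) (hι ?_)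
  rw [map_smul, map_neg, hm, neg_sub, smul_sub, smul_smul, hvα, zero_smul, sub_zero, hvp]

variable {k : Type u} [Field k] [Algebra k R]

/-- A criterion for a module not to lie in the left part. -/
lemma not_inLeftPart {M : ModuleCat.{u} R} {e u : R} (he : e * e = e) (hu : u * e = u)
    (hek : ∀ r, ∃ c : k, e * r * e = c • e)
    (hz : ∀ z, z * u = u → ∃ r, r * u = 0 ∧ r * z ≠ 0)
    {m y : M} (hem : e • m = m) (hum : u • m = 0) (hm : m ≠ 0) (hey : e • y = y)
    (hy : ∀ c : k, y ≠ (c • e) • m) : ¬ InLeftPart R M := by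
  rintro ⟨hMi, hMf, hM⟩
  let L := Submodule.span R {1 - e, u}
  let X : ModuleCat.{u} R := ModuleCat.of R (R ⧸ L)
  have hLm : L ≤ LinearMap.ker (LinearMap.toSpanSingleton R M m) := by
    rw [Submodule.span_le]
    rintro x (rfl | rfl)
    · change (1 - e) • m = 0
      rw [sub_smul, one_smul, hem, sub_self]
    · exact hum
  have h1L : (1 : R) ∉ L := by
    intro h1
    have h2 : (1 : R) • m = 0 := hLm h1
    exact hm (by rwa [one_smul] at h2)
  have hmk : ∀ r : R, (L.mkQ r : R ⧸ L) = r • L.mkQ 1 := by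
    intro r
    rw [← map_smul, smul_eq_mul, mul_one]
  have hmke : (L.mkQ e : R ⧸ L) = L.mkQ 1 := by
    symm
    rw [← sub_eq_zero, ← map_sub]
    exact (Submodule.Quotient.mk_eq_zero L).2 (Submodule.subset_span (by simp))
  have h10 : (L.mkQ 1 : R ⧸ L) ≠ 0 := fun h => h1L ((Submodule.Quotient.mk_eq_zero L).1 h)
  have hXi : Indec R X := by
    refine ⟨⟨L.mkQ 1, 0, h10⟩, fun f hf => ?_⟩
    change (R ⧸ L) →ₗ[R] (R ⧸ L) at f
    have hf1 : ∃ c : k, f (L.mkQ 1) = algebraMap k R c • L.mkQ 1 := by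
      obtain ⟨r, hr⟩ := L.mkQ_surjective (f (L.mkQ 1))
      obtain ⟨c, hc⟩ := hek r
      refine ⟨c, ?_⟩
      have h3 : f (L.mkQ e) = e • L.mkQ r := by
        rw [hmk e, map_smul, hr]
      rw [← hmke, h3, hmk r, ← hmke, hmk e, smul_smul, smul_smul, hc, smul_smul,
        ← Algebra.smul_def]
    obtain ⟨c, hc⟩ := hf1
    have hfx : ∀ x, f x = algebraMap k R c • x := by
      intro x
      obtain ⟨r, rfl⟩ := L.mkQ_surjective x
      rw [hmk r, map_smul, hc, smul_smul, smul_smul, Algebra.commutes]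
    have hcc : algebraMap k R (c * c - c) • (L.mkQ 1 : R ⧸ L) = 0 := by
      have := LinearMap.congr_fun hf (L.mkQ 1)
      change f (f (L.mkQ 1)) = f (L.mkQ 1) at this
      rw [hfx, hfx, smul_smul, ← map_mul] at this
      rw [map_sub, sub_smul, this, sub_self]
    have hc0 : c * c - c = 0 := by
      by_contra hne
      apply h10
      have := congrArg (fun x => algebraMap k R (c * c - c)⁻¹ • x) hcc
      simp only [smul_smul, ← map_mul, inv_mul_cancel₀ hne, smul_zero, map_one, one_smul] at this
      exact this
    have hc1 : c = 0 ∨ c = 1 := by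
      have : c * (c - 1) = 0 := by rw [mul_sub, mul_one, hc0]
      rcases mul_eq_zero.1 this with h | h
      · exact Or.inl h
      · exact Or.inr (sub_eq_zero.1 h)
    rcases hc1 with rfl | rfl
    · left
      refine LinearMap.ext fun x => ?_
      rw [hfx, map_zero, zero_smul]; rfl
    · right
      refine LinearMap.ext fun x => ?_
      rw [hfx, map_one, one_smul]; rfl
  have hXf : FdMod R X := inferInstanceAs (Module.Finite R (R ⧸ L))
  have hstep : Step R X M := by
    refine ⟨hXi, hXf, hMi, hMf, L.liftQ _ hLm, ?_, ?_⟩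
    · intro h0
      have h4 : (1 : R) • m = 0 := LinearMap.congr_fun h0 (L.mkQ 1)
      exact hm (by rwa [one_smul] at h4)
    · rintro ⟨-, hs⟩
      obtain ⟨x, hx⟩ := hs y
      obtain ⟨r, rfl⟩ := L.mkQ_surjective x
      have h5 : r • m = y := hx
      obtain ⟨c, hc⟩ := hek r
      refine hy c ?_
      rw [← hc, ← smul_smul, ← smul_smul, hem, h5, hey]
  obtain ⟨z, hz1, hz2⟩ := exists_of_pdLeOne he hu
    (hM X hXi hXf (Relation.ReflTransGen.single hstep))
  obtain ⟨r, hr, hr'⟩ := hz z hz1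
  exact hr' (hz2 r hr)

end Homological

section QuiverRepresentations

variable {k : Type u} [Field k] {t : ℕ} {ℓ : Fin t → ℕ} {W : Type u} [AddCommGroup W]
  [Module k W] (S : Vtx t ℓ → Submodule k W) (φ : Fin t → ℕ → Module.End k W)

/-- The total space of a representation whose space at the vertex `v` is `S v`. -/
abbrev RepSp : Submodule k (Vtx t ℓ → W) := Submodule.pi Set.univ S

variable {S} in
lemma repSp_mem (m : RepSp S) (v : Vtx t ℓ) : m.1 v ∈ S v := m.2 v trivial

/-- The action of the trivial path at `v`. -/
def repE (v : Vtx t ℓ) : Module.End k (RepSp S) where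
  toFun m := ⟨fun w => if w = v then m.1 w else 0, fun w _ => by
    dsimp only
    split_ifs
    · exact repSp_mem m w
    · exact (S w).zero_mem⟩
  map_add' m n := Subtype.ext (funext fun w => by
    by_cases h : w = v <;> simp [h])
  map_smul' c m := Subtype.ext (funext fun w => by
    by_cases h : w = v <;> simp [h])

lemma repE_apply (v : Vtx t ℓ) (m : RepSp S) (w : Vtx t ℓ) :
    (repE S v m).1 w = if w = v then m.1 w else 0 := rfl

/-- The element of the total space supported at `v` with value `z`. -/
def repMk (v : Vtx t ℓ) (z : W) (hz : z ∈ S v) : RepSp S :=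
  ⟨Pi.single v z, fun w _ => by
    by_cases h : w = v
    · subst h; simpa using hz
    · simp [h]⟩

lemma repMk_same (v : Vtx t ℓ) (z : W) (hz : z ∈ S v) : (repMk S v z hz).1 v = z := by
  simp [repMk]

lemma repE_repMk (v : Vtx t ℓ) (z : W) (hz : z ∈ S v) :
    repE S v (repMk S v z hz) = repMk S v z hz := by
  refine Subtype.ext (funext fun w => ?_)
  rw [repE_apply]
  by_cases h : w = v <;> simp [h, repMk]

variable {S φ} (hφ : ∀ i j, j < ℓ i → ∀ w ∈ S (vtx t ℓ i j), φ i j w ∈ S (vtx t ℓ i (j + 1)))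

/-- The action of the arrows. -/
def repA (i : Fin t) (j : ℕ) : Module.End k (RepSp S) where
  toFun m := ⟨fun w => if j < ℓ i ∧ w = vtx t ℓ i (j + 1) then φ i j (m.1 (vtx t ℓ i j)) else 0,
    fun w _ => by
      dsimp only
      split_ifs with h
      · rw [h.2]
        exact hφ i j h.1 _ (repSp_mem m _)
      · exact (S w).zero_mem⟩
  map_add' m n := Subtype.ext (funext fun w => by
    by_cases h : j < ℓ i ∧ w = vtx t ℓ i (j + 1) <;> simp [h])
  map_smul' c m := Subtype.ext (funext fun w => by
    by_cases h : j < ℓ i ∧ w = vtx t ℓ i (j + 1) <;> simp [h])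

lemma repA_apply (i : Fin t) (j : ℕ) (m : RepSp S) (w : Vtx t ℓ) : (repA hφ i j m).1 w =
    if j < ℓ i ∧ w = vtx t ℓ i (j + 1) then φ i j (m.1 (vtx t ℓ i j)) else 0 := rfl

lemma isRep_op : IsRep (fun v : Vtx t ℓ => op (repE S v)) (fun i j => op (repA hφ i j)) where
  idem v := by
    refine congrArg op (LinearMap.ext fun m => Subtype.ext (funext fun w => ?_))
    change (if w = v then (if w = v then m.1 w else 0) else 0) = if w = v then m.1 w else 0
    split_ifs <;> rfl
  orth v w hvw := by
    refine congrArg op (LinearMap.ext fun m => Subtype.ext (funext fun x => ?_))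
    change (if x = w then (if x = v then m.1 x else 0) else 0) = 0
    split_ifs <;> simp_all
  sum := by
    rw [← Finset.op_sum, ← op_one]
    refine congrArg op (LinearMap.ext fun m => Subtype.ext (funext fun w => ?_))
    simp only [LinearMap.sum_apply, AddSubmonoidClass.coe_finsetSum, Finset.sum_apply, repE_apply]
    simp
  left i j hj := by
    refine congrArg op (LinearMap.ext fun m => Subtype.ext (funext fun w => ?_))
    simp [repA_apply, repE_apply]
  right i j hj := by
    refine congrArg op (LinearMap.ext fun m => Subtype.ext (funext fun w => ?_))
    change (if w = vtx t ℓ i (j + 1) then (if j < ℓ i ∧ w = vtx t ℓ i (j + 1) then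
      φ i j (m.1 (vtx t ℓ i j)) else 0) else 0) =
      if j < ℓ i ∧ w = vtx t ℓ i (j + 1) then φ i j (m.1 (vtx t ℓ i j)) else 0
    split_ifs <;> simp_all
  junk i j hj := by
    refine congrArg op (LinearMap.ext fun m => Subtype.ext (funext fun w => ?_))
    rw [repA_apply, if_neg fun h => absurd h.1 (by omega)]
    rfl

/-- The action of the path along branch `i` from `a` to `b`. -/
def pathMap (φ : Fin t → ℕ → Module.End k W) (i : Fin t) (a b : ℕ) : Module.End k W :=
  unop (icoProd (fun j => op (φ i j)) a b)

lemma pathMap_succ (i : Fin t) {a b : ℕ} (h : a ≤ b) (w : W) :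
    pathMap φ i a (b + 1) w = φ i b (pathMap φ i a b w) := by
  rw [pathMap, ← icoProd_mul _ h (Nat.le_succ b), icoProd_succ]
  rfl

lemma pathMap_cons (i : Fin t) {a b : ℕ} (h : a < b) (w : W) :
    pathMap φ i a b w = pathMap φ i (a + 1) b (φ i a w) := by
  rw [pathMap, icoProd_cons _ h]
  rfl

lemma pathMap_self (i : Fin t) (a : ℕ) (w : W) : pathMap φ i a a w = w := by
  rw [pathMap, icoProd_self]
  rfl

lemma unop_icoProd_repA (i : Fin t) {a b : ℕ} (hab : a < b) (hb : b ≤ ℓ i) (m : RepSp S)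
    (w : Vtx t ℓ) : (unop (icoProd (fun j => op (repA hφ i j)) a b) m).1 w =
      if w = vtx t ℓ i b then pathMap φ i a b (m.1 (vtx t ℓ i a)) else 0 := by
  obtain ⟨n, rfl⟩ : ∃ n, b = a + 1 + n := ⟨b - (a + 1), by omega⟩
  induction n generalizing w with
  | zero =>
    rw [add_zero, icoProd_succ, pathMap, icoProd_succ]
    change (repA hφ i a m).1 w = _
    rw [repA_apply]
    simp [show a < ℓ i by omega]
  | succ n ih =>
    have hle : a ≤ a + 1 + n := by omega
    rw [← add_assoc, ← icoProd_mul _ hle (Nat.le_succ _), icoProd_succ, pathMap_succ i hle]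
    change (repA hφ i (a + 1 + n) (unop (icoProd (fun j => op (repA hφ i j)) a (a + 1 + n)) m)).1 w = _
    rw [repA_apply]
    have h1 := ih (vtx t ℓ i (a + 1 + n)) (by omega) (by omega)
    rw [if_pos rfl] at h1
    rw [← h1]
    simp [show a + 1 + n < ℓ i by omega]

end QuiverRepresentations

section Modules

variable {k : Type u} [Field k] (T : ToupieAlg k) {W : Type u} [AddCommGroup W]
  [Module k W] {S : Vtx T.t T.ℓ → Submodule k W} {φ : Fin T.t → ℕ → Module.End k W}
  (hφ : ∀ i j, j < T.ℓ i → ∀ w ∈ S (vtx T.t T.ℓ i j), φ i j w ∈ S (vtx T.t T.ℓ i (j + 1)))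

/-- A module over a toupie algebra realizing a given representation of the quiver. -/
structure Realizes (M : ModuleCat.{u} (Alg T)ᵐᵒᵖ) (Ψ : M ≃+ RepSp S) : Prop where
  smul : ∀ (x : PathAlg k T.t T.ℓ) (m : M),
    Ψ (op (mkA T x) • m) = unop ((isRep_op hφ).lift x) (Ψ m)

/-- A representation of the quiver satisfying the relations is realized by a module. -/
lemma exists_realizes {c : Fin T.t} (hc : wE c ∉ T.I) {Λ : Fin T.t → k}
    (hΛ : ∀ i, mkA T (wE i) = Λ i • mkA T (wE c))
    (hzero : ∀ i a b, a + 2 ≤ b → b ≤ T.ℓ i → subE i a b ∈ T.I →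
      ∀ w ∈ S (vtx T.t T.ℓ i a), pathMap φ i a b w = 0)
    (hw : ∀ i, ∀ w ∈ S Vtx.src, pathMap φ i 0 (T.ℓ i) w = Λ i • pathMap φ c 0 (T.ℓ c) w) :
    ∃ (M : ModuleCat.{u} (Alg T)ᵐᵒᵖ) (Ψ : M ≃+ RepSp S), Realizes T hφ M Ψ := by
  have key : ∀ x ∈ T.I, (isRep_op hφ).lift x = 0 := by
    intro x hx
    refine IsRep.lift_eq_zero T (isRep_op hφ) hc hΛ ?_ ?_ hx
    · intro i a b hab hb h
      refine unop_injective (LinearMap.ext fun m => Subtype.ext (funext fun w => ?_))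
      rw [unop_icoProd_repA hφ i (by omega) hb, hzero i a b hab hb h _ (repSp_mem m _), ite_self]
      rfl
    · intro i
      refine unop_injective (LinearMap.ext fun m => Subtype.ext (funext fun w => ?_))
      rw [unop_smul, LinearMap.smul_apply]
      change _ = Λ i • (unop (icoProd (fun j => op (repA hφ c j)) 0 (T.ℓ c)) m).1 w
      rw [unop_icoProd_repA hφ i (T.hℓ i) le_rfl, unop_icoProd_repA hφ c (T.hℓ c) le_rfl,
        vtx_of_le (T.hℓ i) le_rfl, vtx_of_le (T.hℓ c) le_rfl, vtx_zero, vtx_zero]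
      split_ifs
      · exact hw i _ (repSp_mem m _)
      · rw [smul_zero]
  let F : Alg T →+* (Module.End k (RepSp S))ᵐᵒᵖ :=
    T.I.ringCon.lift ((isRep_op hφ).lift (k := k)).toRingHom (by
      intro x y hxy
      have h1 : mkA T x = mkA T y := (RingCon.eq _).2 hxy
      have h2 : mkA T (x - y) = 0 := (map_sub (mkA T) x y).trans (sub_eq_zero.2 h1)
      have h3 := key _ ((mkA_eq_zero_iff T).1 h2)
      exact sub_eq_zero.1 ((map_sub ((isRep_op hφ).lift (k := k)) x y).symm.trans h3))
  have hF : ∀ x, F (mkA T x) = (isRep_op hφ).lift x := fun x => rfl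
  let G : (Alg T)ᵐᵒᵖ →+* Module.End k (RepSp S) :=
    { toFun := fun r => unop (F (unop r))
      map_one' := by simp
      map_mul' := by simp
      map_zero' := by simp
      map_add' := by simp }
  let : Module (Alg T)ᵐᵒᵖ (RepSp S) := Module.compHom _ G
  exact ⟨ModuleCat.of _ (RepSp S), AddEquiv.refl _, ⟨fun x m => by
    change unop (F (mkA T x)) m = _
    rw [hF]
    rfl⟩⟩

end Modules

section Realizations

variable {k : Type u} [Field k] {T : ToupieAlg k} {W : Type u} [AddCommGroup W]
  [Module k W] {S : Vtx T.t T.ℓ → Submodule k W} {φ : Fin T.t → ℕ → Module.End k W}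
  {hφ : ∀ i j, j < T.ℓ i → ∀ w ∈ S (vtx T.t T.ℓ i j), φ i j w ∈ S (vtx T.t T.ℓ i (j + 1))}
  {M : ModuleCat.{u} (Alg T)ᵐᵒᵖ} {Ψ : M ≃+ RepSp S}

lemma Realizes.eV_smul (h : Realizes T hφ M Ψ) (v : Vtx T.t T.ℓ) (m : M) :
    Ψ (op (mkA T (eV v)) • m) = repE S v (Ψ m) := by
  rw [h.smul, (isRep_op hφ).lift_eV]
  rfl

lemma Realizes.arE_smul (h : Realizes T hφ M Ψ) (i : Fin T.t) (j : ℕ) (m : M) :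
    Ψ (op (mkA T (arE i j)) • m) = repA hφ i j (Ψ m) := by
  rw [h.smul, (isRep_op hφ).lift_arE]
  rfl

lemma Realizes.subE_smul (h : Realizes T hφ M Ψ) (i : Fin T.t) {a b : ℕ} (hab : a < b)
    (hb : b ≤ T.ℓ i) (m : M) (w : Vtx T.t T.ℓ) :
    (Ψ (op (mkA T (subE i a b)) • m)).1 w =
      if w = vtx T.t T.ℓ i b then pathMap φ i a b ((Ψ m).1 (vtx T.t T.ℓ i a)) else 0 := by
  rw [h.smul, (isRep_op hφ).lift_subE]
  exact unop_icoProd_repA hφ i hab hb (Ψ m) w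

lemma algebraMap_op_eq (r : k) : algebraMap k (Alg T)ᵐᵒᵖ r =
    op (mkA T (algebraMap k (PathAlg k T.t T.ℓ) r)) := rfl

lemma Realizes.algebraMap_smul (h : Realizes T hφ M Ψ) (r : k) (m : M) :
    Ψ (algebraMap k (Alg T)ᵐᵒᵖ r • m) = r • Ψ m := by
  rw [algebraMap_op_eq, h.smul, AlgHom.commutes]
  rfl

lemma Realizes.algebraMap_smul_symm (h : Realizes T hφ M Ψ) (r : k) (m : RepSp S) :
    Ψ.symm (r • m) = algebraMap k (Alg T)ᵐᵒᵖ r • Ψ.symm m := by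
  rw [AddEquiv.symm_apply_eq, h.algebraMap_smul, AddEquiv.apply_symm_apply]

lemma Realizes.fdMod (h : Realizes T hφ M Ψ) [Module.Finite k W] : FdMod _ M := by
  have : Module.Finite k (RepSp S) := inferInstance
  obtain ⟨s, hs⟩ := this.fg_top
  refine ⟨⟨s.image Ψ.symm, ?_⟩⟩
  rw [eq_top_iff]
  rintro m -
  obtain ⟨m, rfl⟩ := Ψ.symm.surjective m
  have hm : m ∈ Submodule.span k (s : Set (RepSp S)) := hs ▸ Submodule.mem_top
  induction hm using Submodule.span_induction with
  | mem x hx =>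
    exact Submodule.subset_span (by simpa using hx)
  | zero => rw [map_zero]; exact Submodule.zero_mem _
  | add x y _ _ hx hy => rw [map_add]; exact Submodule.add_mem _ hx hy
  | smul r x _ hx =>
    rw [h.algebraMap_smul_symm]
    exact Submodule.smul_mem _ _ hx

variable {W' : Type u} [AddCommGroup W']
  [Module k W'] {S' : Vtx T.t T.ℓ → Submodule k W'} {φ' : Fin T.t → ℕ → Module.End k W'}
  {hφ' : ∀ i j, j < T.ℓ i → ∀ w ∈ S' (vtx T.t T.ℓ i j), φ' i j w ∈ S' (vtx T.t T.ℓ i (j + 1))}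
  {M' : ModuleCat.{u} (Alg T)ᵐᵒᵖ} {Ψ' : M' ≃+ RepSp S'}

/-- The linear map between total spaces induced by a homomorphism. -/
def Realizes.conj (h : Realizes T hφ M Ψ) (h' : Realizes T hφ' M' Ψ')
    (f : M →ₗ[(Alg T)ᵐᵒᵖ] M') : RepSp S →ₗ[k] RepSp S' where
  toFun m := Ψ' (f (Ψ.symm m))
  map_add' m n := by simp
  map_smul' r m := by
    rw [h.algebraMap_smul_symm, map_smul, h'.algebraMap_smul]
    rfl

lemma Realizes.conj_apply (h : Realizes T hφ M Ψ) (h' : Realizes T hφ' M' Ψ')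
    (f : M →ₗ[(Alg T)ᵐᵒᵖ] M') (m : RepSp S) : h.conj h' f m = Ψ' (f (Ψ.symm m)) := rfl

lemma Realizes.conj_repE (h : Realizes T hφ M Ψ) (h' : Realizes T hφ' M' Ψ')
    (f : M →ₗ[(Alg T)ᵐᵒᵖ] M') (v : Vtx T.t T.ℓ) (m : RepSp S) :
    h.conj h' f (repE S v m) = repE S' v (h.conj h' f m) := by
  have h1 : Ψ.symm (repE S v m) = op (mkA T (eV v)) • Ψ.symm m := by
    rw [AddEquiv.symm_apply_eq, h.eV_smul, AddEquiv.apply_symm_apply]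
  rw [h.conj_apply h', h1, map_smul, h'.eV_smul, h.conj_apply h']

lemma Realizes.conj_repA (h : Realizes T hφ M Ψ) (h' : Realizes T hφ' M' Ψ')
    (f : M →ₗ[(Alg T)ᵐᵒᵖ] M') (i : Fin T.t) (j : ℕ) (m : RepSp S) :
    h.conj h' f (repA hφ i j m) = repA hφ' i j (h.conj h' f m) := by
  have h1 : Ψ.symm (repA hφ i j m) = op (mkA T (arE i j)) • Ψ.symm m := by
    rw [AddEquiv.symm_apply_eq, h.arE_smul, AddEquiv.apply_symm_apply]
  rw [h.conj_apply h', h1, map_smul, h'.arE_smul, h.conj_apply h']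

lemma Realizes.conj_congr (h : Realizes T hφ M Ψ) (h' : Realizes T hφ' M' Ψ')
    (f : M →ₗ[(Alg T)ᵐᵒᵖ] M') (v : Vtx T.t T.ℓ) {m n : RepSp S} (hmn : m.1 v = n.1 v) :
    (h.conj h' f m).1 v = (h.conj h' f n).1 v := by
  have h1 : repE S v m = repE S v n := by
    refine Subtype.ext (funext fun w => ?_)
    rw [repE_apply, repE_apply]
    split_ifs with hw
    · rw [hw, hmn]
    · rfl
  have h2 := congrArg (fun x => (h.conj h' f x).1 v) h1
  simpa only [h.conj_repE h', repE_apply, if_true] using h2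

lemma Realizes.conj_arrow (h : Realizes T hφ M Ψ) (h' : Realizes T hφ' M' Ψ')
    (f : M →ₗ[(Alg T)ᵐᵒᵖ] M') {i : Fin T.t} {j : ℕ} (hj : j < T.ℓ i) {m n : RepSp S}
    (hmn : n.1 (vtx T.t T.ℓ i (j + 1)) = φ i j (m.1 (vtx T.t T.ℓ i j))) :
    (h.conj h' f n).1 (vtx T.t T.ℓ i (j + 1)) =
      φ' i j ((h.conj h' f m).1 (vtx T.t T.ℓ i j)) := by
  have h1 : (repA hφ i j m).1 (vtx T.t T.ℓ i (j + 1)) = φ i j (m.1 (vtx T.t T.ℓ i j)) := by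
    rw [repA_apply, if_pos ⟨hj, rfl⟩]
  rw [h.conj_congr h' f _ (hmn.trans h1.symm), h.conj_repA h', repA_apply, if_pos ⟨hj, rfl⟩]

/-- Isomorphic modules have isomorphic spaces at each vertex. -/
lemma Realizes.finrank_eq (h : Realizes T hφ M Ψ) (h' : Realizes T hφ' M' Ψ')
    (f : M ≃ₗ[(Alg T)ᵐᵒᵖ] M') (v : Vtx T.t T.ℓ) (hS : ∀ z, z ∈ S v) (hS' : ∀ z, z ∈ S' v) :
    Module.finrank k W = Module.finrank k W' := by
  let F := h.conj h' (f : M →ₗ[(Alg T)ᵐᵒᵖ] M')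
  let G := h'.conj h (f.symm : M' →ₗ[(Alg T)ᵐᵒᵖ] M)
  have hFG : ∀ m, F (G m) = m := fun m => by simp [F, G, Realizes.conj_apply]
  have hGF : ∀ m, G (F m) = m := fun m => by simp [F, G, Realizes.conj_apply]
  refine LinearEquiv.finrank_eq
    { toFun := fun z => (F (repMk S v z (hS z))).1 v
      invFun := fun z => (G (repMk S' v z (hS' z))).1 v
      map_add' := fun y z => ?_
      map_smul' := fun r z => ?_
      left_inv := fun z => ?_
      right_inv := fun z => ?_ }
  · have h1 := h.conj_congr h' (f : M →ₗ[(Alg T)ᵐᵒᵖ] M') v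
      (m := repMk S v (y + z) (hS _)) (n := repMk S v y (hS _) + repMk S v z (hS _))
      (by simp [repMk])
    rw [map_add] at h1
    exact h1
  · have h1 := h.conj_congr h' (f : M →ₗ[(Alg T)ᵐᵒᵖ] M') v
      (m := repMk S v (r • z) (hS _)) (n := r • repMk S v z (hS _)) (by simp [repMk])
    rw [map_smul] at h1
    exact h1
  · dsimp only
    rw [h'.conj_congr h (f.symm : M' →ₗ[(Alg T)ᵐᵒᵖ] M) v (n := F (repMk S v z (hS z)))
      (repMk_same S' v _ _)]
    exact (congrArg (fun m => m.1 v) (hGF _)).trans (repMk_same S v _ _)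
  · dsimp only
    rw [h.conj_congr h' (f : M →ₗ[(Alg T)ᵐᵒᵖ] M') v (n := G (repMk S' v z (hS' z)))
      (repMk_same S v _ _)]
    exact (congrArg (fun m => m.1 v) (hFG _)).trans (repMk_same S' v _ _)

end Realizations

section ZeroPairs

/-- Two distinct branches lying in the ideal of a toupie algebra with `dim e₀ A e∞ = 1`, with a
position on each of them from which the rest of the branch is nonzero. -/
structure ZeroPair {k : Type u} [Field k] (T : ToupieAlg k) where
  c : Fin T.t
  Λ : Fin T.t → k
  hc : wE c ∉ T.I
  hΛ : ∀ i, mkA T (wE i) = Λ i • mkA T (wE c)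
  i₁ : Fin T.t
  i₂ : Fin T.t
  hne : i₂ ≠ i₁
  s : Fin T.t → ℕ
  mem : ∀ i, i = i₁ ∨ i = i₂ → wE i ∈ T.I
  one_le : ∀ i, i = i₁ ∨ i = i₂ → 1 ≤ s i
  lt : ∀ i, i = i₁ ∨ i = i₂ → s i < T.ℓ i
  notMem : ∀ i, i = i₁ ∨ i = i₂ → subE i (s i) (T.ℓ i) ∉ T.I

namespace ZeroPair

variable {k : Type u} [Field k] {T : ToupieAlg k} (D : ZeroPair T)

/-- The two selected branches. -/
def Act (i : Fin T.t) : Prop := i = D.i₁ ∨ i = D.i₂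

lemma wE_mem_of_Λ_eq_zero {i : Fin T.t} (h : D.Λ i = 0) : wE i ∈ T.I := by
  rw [← mkA_eq_zero_iff, D.hΛ, h, zero_smul]

lemma Λ_eq_zero_of_mem {i : Fin T.t} (h : wE i ∈ T.I) : D.Λ i = 0 := by
  by_contra hne
  have h1 := D.hΛ i
  rw [(mkA_eq_zero_iff T).2 h] at h1
  have h2 : mkA T (wE D.c) = 0 := by
    rw [← one_smul k (mkA T (wE D.c)), ← inv_mul_cancel₀ hne, mul_smul, ← h1, smul_zero]
  exact D.hc ((mkA_eq_zero_iff T).1 h2)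

lemma Λ_act {i : Fin T.t} (h : D.Act i) : D.Λ i = 0 := D.Λ_eq_zero_of_mem (D.mem i h)

lemma Λ_c : D.Λ D.c = 1 := by
  by_contra hne
  refine D.hc ?_
  rw [← mkA_eq_zero_iff]
  have h1 : (D.Λ D.c - 1) • mkA T (wE D.c) = 0 := by
    rw [sub_smul, one_smul, ← D.hΛ, sub_self]
  rw [← one_smul k (mkA T (wE D.c)), ← inv_mul_cancel₀ (sub_ne_zero.2 hne), mul_smul, h1,
    smul_zero]

lemma wE_mem_of_subE_mem {i : Fin T.t} {a b : ℕ} (hab : a ≤ b) (hb : b ≤ T.ℓ i)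
    (h : subE i a b ∈ T.I) : wE i ∈ T.I := by
  have h1 : (wE i : PathAlg k T.t T.ℓ) = subE i 0 a * subE i a b * subE i b (T.ℓ i) := by
    rw [subE_mul_subE T i (Nat.zero_le a) hab, subE_mul_subE T i (Nat.zero_le b) hb]
    rfl
  rw [h1]
  exact T.I.mul_mem_right _ _ (T.I.mul_mem_left _ _ h)

variable {E : Type u} [CommRing E] [Algebra k E] (x : E)

/-- The projection used at the beginning of a selected branch. -/
def proj (i : Fin T.t) : E × E →ₗ[k] E :=
  if i = D.i₁ then LinearMap.fst k E E else LinearMap.snd k E E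

/-- The embedding used at the end of a selected branch. -/
def emb (i : Fin T.t) : E →ₗ[k] E × E :=
  LinearMap.prod LinearMap.id (if i = D.i₁ then LinearMap.id else LinearMap.mulLeft k x)

lemma emb_injective (i : Fin T.t) : Function.Injective (D.emb x i) :=
  fun _ _ h => congrArg Prod.fst h

lemma emb_i₁ (y : E) : D.emb x D.i₁ y = (y, y) := by simp [emb]

lemma emb_i₂ (y : E) : D.emb x D.i₂ y = (y, x * y) := by simp [emb, D.hne]

lemma proj_i₁ (w : E × E) : D.proj (k := k) D.i₁ w = w.1 := by simp [proj]

lemma proj_i₂ (w : E × E) : D.proj (k := k) D.i₂ w = w.2 := by simp [proj, D.hne]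

lemma proj_surjective (i : Fin T.t) (y : E) : ∃ w : E × E, D.proj (k := k) i w = y := by
  by_cases h : i = D.i₁
  · exact ⟨(y, 0), by simp [proj, h]⟩
  · exact ⟨(0, y), by simp [proj, h]⟩

/-- The arrows of the representation. -/
def phi (i : Fin T.t) (j : ℕ) : Module.End k (E × E) :=
  if D.Λ i ≠ 0 then (if j + 1 = T.ℓ i then D.Λ i • LinearMap.id else LinearMap.id)
  else if D.Act i then
    (if j = 0 then LinearMap.inl k E E ∘ₗ D.proj i
      else if j + 1 = T.ℓ i then D.emb x i ∘ₗ LinearMap.snd k E E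
      else if D.s i ≤ j then LinearMap.inr k E E ∘ₗ LinearMap.snd k E E else 0)
  else 0

/-- The space of the representation at the `a`-th vertex of branch `i`. -/
def midSp (E : Type u) [CommRing E] [Algebra k E] (i : Fin T.t) (a : ℕ) : Submodule k (E × E) :=
  if D.Λ i ≠ 0 then ⊤
  else if D.Act i then Submodule.prod (if a = 1 then ⊤ else ⊥) (if D.s i ≤ a then ⊤ else ⊥)
  else ⊥

/-- The spaces of the representation. -/
def sp (E : Type u) [CommRing E] [Algebra k E] : Vtx T.t T.ℓ → Submodule k (E × E)
  | .src => ⊤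
  | .snk => ⊤
  | .mid i a => D.midSp E i (a + 1)

lemma sp_zero (i : Fin T.t) : D.sp E (vtx T.t T.ℓ i 0) = ⊤ := by rw [vtx_zero]; rfl

lemma sp_end (i : Fin T.t) : D.sp E (vtx T.t T.ℓ i (T.ℓ i)) = ⊤ := by
  rw [vtx_of_le (T.hℓ i) le_rfl]; rfl

lemma sp_mid {i : Fin T.t} {a : ℕ} (h0 : 0 < a) (ha : a < T.ℓ i) :
    D.sp E (vtx T.t T.ℓ i a) = D.midSp E i a := by
  rw [vtx_mid h0 ha]
  change D.midSp E i (a - 1 + 1) = _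
  rw [Nat.sub_add_cancel h0]

lemma sp_of_ne {i : Fin T.t} (hi : D.Λ i ≠ 0) {a : ℕ} (ha : a ≤ T.ℓ i) :
    D.sp E (vtx T.t T.ℓ i a) = ⊤ := by
  rcases Nat.eq_zero_or_pos a with rfl | h0
  · exact D.sp_zero i
  rcases ha.eq_or_lt with rfl | ha
  · exact D.sp_end i
  rw [D.sp_mid h0 ha, midSp, if_pos hi]

lemma mem_sp_act {i : Fin T.t} (hi : D.Act i) {a : ℕ} (h0 : 0 < a) (ha : a < T.ℓ i)
    {w : E × E} : w ∈ D.sp E (vtx T.t T.ℓ i a) ↔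
      (a = 1 ∨ w.1 = 0) ∧ (D.s i ≤ a ∨ w.2 = 0) := by
  rw [D.sp_mid h0 ha, midSp, if_neg (not_not.2 (D.Λ_act hi)), if_pos hi, Submodule.mem_prod]
  split_ifs <;> simp_all

lemma phi_of_ne {i : Fin T.t} (hi : D.Λ i ≠ 0) {j : ℕ} (hj : j + 1 < T.ℓ i) (w : E × E) :
    D.phi x i j w = w := by
  rw [phi, if_pos hi, if_neg hj.ne]
  rfl

lemma phi_of_ne_last {i : Fin T.t} (hi : D.Λ i ≠ 0) {j : ℕ} (hj : j + 1 = T.ℓ i) (w : E × E) :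
    D.phi x i j w = D.Λ i • w := by
  rw [phi, if_pos hi, if_pos hj]
  rfl

lemma phi_zero {i : Fin T.t} (hi : D.Act i) (w : E × E) :
    D.phi x i 0 w = (D.proj (k := k) i w, 0) := by
  rw [phi, if_neg (not_not.2 (D.Λ_act hi)), if_pos hi, if_pos rfl]
  rfl

lemma phi_last {i : Fin T.t} (hi : D.Act i) {j : ℕ} (h0 : 0 < j) (hj : j + 1 = T.ℓ i)
    (w : E × E) : D.phi x i j w = D.emb (k := k) x i w.2 := by
  rw [phi, if_neg (not_not.2 (D.Λ_act hi)), if_pos hi, if_neg h0.ne', if_pos hj]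
  rfl

lemma phi_mid {i : Fin T.t} (hi : D.Act i) {j : ℕ} (h0 : 0 < j) (hj : j + 1 < T.ℓ i)
    (h : D.s i ≤ j) (w : E × E) : D.phi x i j w = (0, w.2) := by
  rw [phi, if_neg (not_not.2 (D.Λ_act hi)), if_pos hi, if_neg h0.ne', if_neg hj.ne, if_pos h]
  rfl

lemma phi_early {i : Fin T.t} (hi : D.Act i) {j : ℕ} (h0 : 0 < j) (hj : j + 1 < T.ℓ i)
    (h : j < D.s i) (w : E × E) : D.phi x i j w = 0 := by
  rw [phi, if_neg (not_not.2 (D.Λ_act hi)), if_pos hi, if_neg h0.ne', if_neg hj.ne,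
    if_neg h.not_ge]
  rfl

lemma phi_of_not_act {i : Fin T.t} (hi : D.Λ i = 0) (hA : ¬ D.Act i) (j : ℕ) (w : E × E) :
    D.phi x i j w = 0 := by
  rw [phi, if_neg (not_not.2 hi), if_neg hA]
  rfl

lemma phi_mem (i : Fin T.t) (j : ℕ) (hj : j < T.ℓ i) (w : E × E)
    (_ : w ∈ D.sp E (vtx T.t T.ℓ i j)) : D.phi x i j w ∈ D.sp E (vtx T.t T.ℓ i (j + 1)) := by
  by_cases hi : D.Λ i = 0
  swap
  · rw [D.sp_of_ne hi hj]
    trivial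
  by_cases hA : D.Act i
  swap
  · rw [D.phi_of_not_act x hi hA]
    exact Submodule.zero_mem _
  rcases (Nat.succ_le_of_lt hj).eq_or_lt with h | h
  · rw [show j + 1 = T.ℓ i from h, D.sp_end]
    trivial
  rw [D.mem_sp_act hA (Nat.succ_pos j) h]
  rcases Nat.eq_zero_or_pos j with rfl | h0
  · rw [D.phi_zero x hA]
    simp
  by_cases hs : D.s i ≤ j
  · rw [D.phi_mid x hA h0 h hs]
    exact ⟨Or.inr rfl, Or.inl (by omega)⟩
  · rw [D.phi_early x hA h0 h (by omega)]
    simp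

lemma pathMap_zero (i : Fin T.t) (a b : ℕ) (hab : a + 2 ≤ b) (hb : b ≤ T.ℓ i)
    (h : subE i a b ∈ T.I) (w : E × E) (_ : w ∈ D.sp E (vtx T.t T.ℓ i a)) :
    pathMap (D.phi x) i a b w = 0 := by
  have hi : D.Λ i = 0 := D.Λ_eq_zero_of_mem (wE_mem_of_subE_mem (by omega) hb h)
  have hab' : a < b := by omega
  rw [pathMap_cons i hab']
  by_cases hA : D.Act i
  swap
  · rw [D.phi_of_not_act x hi hA, map_zero]
  rcases Nat.eq_zero_or_pos a with rfl | h0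
  · rw [D.phi_zero x hA, pathMap_cons i (by omega : 0 + 1 < b)]
    rcases (show 0 + 1 + 1 ≤ T.ℓ i by omega).eq_or_lt with h1 | h1
    · rw [D.phi_last x hA (by omega) h1, map_zero, map_zero]
    by_cases hs : D.s i ≤ 0 + 1
    · rw [D.phi_mid x hA (by omega) h1 hs]
      exact map_zero _
    · rw [D.phi_early x hA (by omega) h1 (by omega), map_zero]
  by_cases hs : D.s i ≤ a
  · refine absurd ?_ (D.notMem i hA)
    rw [← subE_mul_subE T i hs (by omega : a ≤ T.ℓ i), ← subE_mul_subE T i hab'.le hb]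
    exact T.I.mul_mem_left _ _ (T.I.mul_mem_right _ _ h)
  · rw [D.phi_early x hA h0 (by omega) (by omega), map_zero]

lemma pathMap_of_ne {i : Fin T.t} (hi : D.Λ i ≠ 0) (w : E × E) :
    pathMap (D.phi x) i 0 (T.ℓ i) w = D.Λ i • w := by
  obtain ⟨n, hn⟩ : ∃ n, T.ℓ i = n + 1 := ⟨T.ℓ i - 1, by have := T.hℓ i; omega⟩
  have key : ∀ b ≤ n, pathMap (D.phi x) i 0 b w = w := by
    intro b hb
    induction b with
    | zero => exact pathMap_self i 0 w
    | succ b ih => rw [pathMap_succ i (Nat.zero_le b), ih (by omega), D.phi_of_ne x hi (by omega)]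
  rw [hn, pathMap_succ i (Nat.zero_le n), key n le_rfl, D.phi_of_ne_last x hi hn.symm]

lemma two_le_of_mem {i : Fin T.t} (h : wE i ∈ T.I) : 2 ≤ T.ℓ i := by
  by_contra hlt
  exact subE_succ_notMem T (i := i) (a := 0) (b := T.ℓ i) (by omega) (T.hℓ i) le_rfl h

lemma exists_realizes : ∃ (M : ModuleCat.{u} (Alg T)ᵐᵒᵖ) (Ψ : M ≃+ RepSp (D.sp E)),
    Realizes T (D.phi_mem x) M Ψ := by
  refine Toupie.exists_realizes T (D.phi_mem x) D.hc D.hΛ (D.pathMap_zero x) fun i w hw => ?_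
  rw [D.pathMap_of_ne x (i := D.c) (by rw [D.Λ_c]; exact one_ne_zero), D.Λ_c, one_smul]
  by_cases hi : D.Λ i = 0
  · have h := D.wE_mem_of_Λ_eq_zero hi
    rw [hi, zero_smul]
    refine D.pathMap_zero x i 0 (T.ℓ i) (by have := two_le_of_mem h; omega) le_rfl h w ?_
    rw [vtx_zero]
    exact hw
  · exact D.pathMap_of_ne x hi w

end ZeroPair

end ZeroPairs

section Indecomposable

namespace ZeroPair

variable {k : Type u} [Field k] {T : ToupieAlg k} {D : ZeroPair T}
  {E : Type u} [CommRing E] [Algebra k E] {x : E}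
  {M : ModuleCat.{u} (Alg T)ᵐᵒᵖ} {Ψ : M ≃+ RepSp (D.sp E)}

/-- The element of the representation supported at the source with value `w`. -/
def srcMk (D : ZeroPair T) (w : E × E) : RepSp (D.sp E) := repMk (D.sp E) .src w trivial

lemma srcMk_src (w : E × E) : (srcMk D w).1 .src = w := repMk_same _ _ _ _

/-- The map induced at the source by an endomorphism. -/
def srcEnd (h : Realizes T (D.phi_mem x) M Ψ) (f : M →ₗ[(Alg T)ᵐᵒᵖ] M) (w : E × E) : E × E :=
  (h.conj h f (srcMk D w)).1 .src

variable (h : Realizes T (D.phi_mem x) M Ψ) (f : M →ₗ[(Alg T)ᵐᵒᵖ] M)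

include h in
lemma conj_src (m : RepSp (D.sp E)) : (h.conj h f m).1 .src = srcEnd h f (m.1 .src) :=
  h.conj_congr h f .src (srcMk_src _).symm

lemma srcEnd_add (v w : E × E) : srcEnd h f (v + w) = srcEnd h f v + srcEnd h f w := by
  have h1 := conj_src h f (srcMk D v + srcMk D w)
  have h2 : (srcMk D v + srcMk D w).1 .src = v + w :=
    congrArg₂ (· + ·) (srcMk_src v) (srcMk_src w)
  rw [h2, map_add] at h1
  exact h1.symm

lemma srcEnd_smul (r : k) (w : E × E) : srcEnd h f (r • w) = r • srcEnd h f w := by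
  have h1 := conj_src h f (r • srcMk D w)
  have h2 : (r • srcMk D w).1 .src = r • w := congrArg (r • ·) (srcMk_src w)
  rw [h2, map_smul] at h1
  exact h1.symm

lemma conj_of_ne {i : Fin T.t} (hi : D.Λ i ≠ 0) {b : ℕ} (hb : b < T.ℓ i) (m : RepSp (D.sp E)) :
    (h.conj h f m).1 (vtx T.t T.ℓ i b) = srcEnd h f (m.1 (vtx T.t T.ℓ i b)) := by
  induction b generalizing m with
  | zero =>
    rw [vtx_zero]
    exact conj_src h f m
  | succ b ih =>
    have hb' : b < T.ℓ i := by omega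
    let n := repMk (D.sp E) (vtx T.t T.ℓ i b) (m.1 (vtx T.t T.ℓ i (b + 1)))
      (by rw [D.sp_of_ne hi hb'.le]; trivial)
    have hn : n.1 (vtx T.t T.ℓ i b) = m.1 (vtx T.t T.ℓ i (b + 1)) := repMk_same _ _ _ _
    rw [h.conj_arrow h f hb' (m := n) (by rw [hn, D.phi_of_ne x hi hb]), D.phi_of_ne x hi hb,
      ih hb', hn]

lemma conj_snk (m : RepSp (D.sp E)) : (h.conj h f m).1 .snk = srcEnd h f (m.1 .snk) := by
  have hi : D.Λ D.c ≠ 0 := by rw [D.Λ_c]; exact one_ne_zero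
  obtain ⟨j, hj⟩ : ∃ j, T.ℓ D.c = j + 1 := ⟨T.ℓ D.c - 1, by have := T.hℓ D.c; omega⟩
  have hj' : j < T.ℓ D.c := by omega
  have hv : vtx T.t T.ℓ D.c (j + 1) = .snk := vtx_of_le (Nat.succ_pos j) hj.le
  let n := repMk (D.sp E) (vtx T.t T.ℓ D.c j) (m.1 .snk) (by rw [D.sp_of_ne hi hj'.le]; trivial)
  have hn : n.1 (vtx T.t T.ℓ D.c j) = m.1 .snk := repMk_same _ _ _ _
  rw [← hv, h.conj_arrow h f hj' (m := n) (by
    rw [hn, hv, D.phi_of_ne_last x hi hj.symm, D.Λ_c, one_smul]),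
    D.phi_of_ne_last x hi hj.symm, conj_of_ne h f hi hj', hn, D.Λ_c, one_smul, hv]

lemma conj_first {i : Fin T.t} (hi : D.Act i) (m : RepSp (D.sp E)) (w : E × E)
    (hm : m.1 (vtx T.t T.ℓ i (0 + 1)) = (D.proj (k := k) i w, 0)) :
    (h.conj h f m).1 (vtx T.t T.ℓ i (0 + 1)) = (D.proj (k := k) i (srcEnd h f w), 0) := by
  rw [h.conj_arrow h f (T.hℓ i) (m := srcMk D w) (by
    rw [vtx_zero, srcMk_src, hm, D.phi_zero x hi]), vtx_zero, D.phi_zero x hi]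
  rfl

lemma proj_srcEnd {i : Fin T.t} (hi : D.Act i) {w : E × E} (hw : D.proj (k := k) i w = 0) :
    D.proj (k := k) i (srcEnd h f w) = 0 := by
  have h1 := conj_first h f hi 0 w (by rw [hw]; rfl)
  rw [map_zero] at h1
  exact (congrArg Prod.fst h1).symm

lemma conj_last {i : Fin T.t} (hi : D.Act i) {j : ℕ} (h0 : 0 < j) (hj : j + 1 = T.ℓ i)
    (m : RepSp (D.sp E)) :
    D.emb (k := k) x i ((h.conj h f m).1 (vtx T.t T.ℓ i j)).2 =
      srcEnd h f (D.emb (k := k) x i (m.1 (vtx T.t T.ℓ i j)).2) := by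
  have hv : vtx T.t T.ℓ i (j + 1) = .snk := vtx_of_le (Nat.succ_pos j) hj.ge
  have hj' : j < T.ℓ i := by omega
  let n := repMk (D.sp E) .snk (D.emb (k := k) x i (m.1 (vtx T.t T.ℓ i j)).2) trivial
  have hn : n.1 .snk = D.emb (k := k) x i (m.1 (vtx T.t T.ℓ i j)).2 := repMk_same _ _ _ _
  rw [← D.phi_last x hi h0 hj, ← h.conj_arrow h f hj' (m := m) (n := n) (by
    rw [hv, hn, D.phi_last x hi h0 hj]), hv, conj_snk, hn]

lemma exists_emb_eq {i : Fin T.t} (hi : D.Act i) (y : E) :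
    ∃ z, srcEnd h f (D.emb (k := k) x i y) = D.emb (k := k) x i z := by
  have h1 := D.one_le i hi
  have h2 := D.lt i hi
  obtain ⟨j, hj⟩ : ∃ j, T.ℓ i = j + 1 := ⟨T.ℓ i - 1, by omega⟩
  let m := repMk (D.sp E) (vtx T.t T.ℓ i j) (0, y)
    ((D.mem_sp_act hi (by omega) (by omega)).2 ⟨Or.inr rfl, Or.inl (by omega)⟩)
  have hm : m.1 (vtx T.t T.ℓ i j) = (0, y) := repMk_same _ _ _ _
  exact ⟨_, by rw [conj_last h f hi (by omega) hj.symm m, hm]⟩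

/-- Endomorphisms of the representation are scalar at the source. -/
lemma exists_srcEnd_eq
    (hx : ∀ g : E →ₗ[k] E, (∀ z, g (x * z) = x * g z) → ∀ z, g z = g 1 * z) :
    ∃ p : E, ∀ w, srcEnd h f w = (p * w.1, p * w.2) := by
  let g : E →ₗ[k] E :=
    { toFun := fun y => (srcEnd h f (y, 0)).1
      map_add' := fun y z => by
        rw [← Prod.fst_add, ← srcEnd_add, Prod.mk_add_mk, add_zero]
      map_smul' := fun r y => by
        rw [RingHom.id_apply, ← Prod.smul_fst, ← srcEnd_smul, Prod.smul_mk, smul_zero] }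
  have h1 : ∀ w, (srcEnd h f w).1 = g w.1 := by
    intro w
    have h2 : D.proj (k := k) D.i₁ (srcEnd h f (0, w.2)) = 0 :=
      proj_srcEnd h f (Or.inl rfl) (D.proj_i₁ _)
    rw [proj_i₁] at h2
    conv_lhs => rw [show w = (w.1, 0) + (0, w.2) by simp, srcEnd_add, Prod.fst_add, h2, add_zero]
    rfl
  have h3 : ∀ w, (srcEnd h f w).2 = (srcEnd h f (0, w.2)).2 := by
    intro w
    have h2 : D.proj (k := k) D.i₂ (srcEnd h f (w.1, 0)) = 0 :=
      proj_srcEnd h f (Or.inr rfl) (D.proj_i₂ _)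
    rw [proj_i₂] at h2
    conv_lhs => rw [show w = (w.1, 0) + (0, w.2) by simp, srcEnd_add, Prod.snd_add, h2, zero_add]
  have h4 : ∀ y, (srcEnd h f (0, y)).2 = g y := by
    intro y
    obtain ⟨z, hz⟩ := exists_emb_eq h f (i := D.i₁) (Or.inl rfl) y
    rw [emb_i₁, emb_i₁] at hz
    have h5 := h1 (y, y)
    have h6 := h3 (y, y)
    rw [hz] at h5 h6
    exact h6.symm.trans h5
  refine ⟨g 1, fun w => Prod.ext ?_ ?_⟩
  all_goals
    have h5 : ∀ z, g z = g 1 * z := hx g fun y => by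
      obtain ⟨z, hz⟩ := exists_emb_eq h f (i := D.i₂) (Or.inr rfl) y
      rw [emb_i₂, emb_i₂] at hz
      have h6 := h1 (y, x * y)
      have h7 := (h3 (y, x * y)).trans (h4 _)
      rw [hz] at h6 h7
      rw [← h7, ← h6]
  · rw [h1, h5]
  · rw [h3, h4, h5]

/-- An idempotent endomorphism of the representation vanishing at the source is zero. -/
lemma eq_zero_of_srcEnd (hf : f.comp f = f) (hz : ∀ w, srcEnd h f w = 0) : f = 0 := by
  have hff : ∀ m, h.conj h f (h.conj h f m) = h.conj h f m := by
    intro m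
    rw [h.conj_apply h, h.conj_apply h, AddEquiv.symm_apply_apply]
    exact congrArg Ψ (LinearMap.congr_fun hf _)
  have key : ∀ (i : Fin T.t) (a : ℕ), 0 < a → a < T.ℓ i → ∀ m : RepSp (D.sp E),
      (h.conj h f m).1 (vtx T.t T.ℓ i a) = 0 := by
    intro i a h0 ha m
    by_cases hi : D.Λ i = 0
    swap
    · rw [conj_of_ne h f hi ha, hz]
    by_cases hA : D.Act i
    swap
    · have h1 := repSp_mem (h.conj h f m) (vtx T.t T.ℓ i a)
      rw [D.sp_mid h0 ha, midSp, if_neg (not_not.2 hi), if_neg hA] at h1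
      exact h1
    have c1 : ∀ m : RepSp (D.sp E), (m.1 (vtx T.t T.ℓ i a)).2 = 0 →
        (h.conj h f m).1 (vtx T.t T.ℓ i a) = 0 := by
      intro m hm
      rcases ((D.mem_sp_act hA h0 ha).1 (repSp_mem m _)).1 with rfl | h1
      · obtain ⟨w, hw⟩ := D.proj_surjective (k := k) i (m.1 (vtx T.t T.ℓ i 1)).1
        have h2 := conj_first h f hA m w (Prod.ext hw.symm hm)
        rw [hz, map_zero] at h2
        exact h2
      · have h2 := h.conj_congr h f (vtx T.t T.ℓ i a) (m := m) (n := 0) (Prod.ext h1 hm)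
        rw [map_zero] at h2
        exact h2
    have c2 : ∀ n a, 0 < a → a + n + 1 = T.ℓ i → ∀ m : RepSp (D.sp E),
        ((h.conj h f m).1 (vtx T.t T.ℓ i a)).2 = 0 := by
      intro n
      induction n with
      | zero =>
        intro a h0 ha m
        have h1 := conj_last h f hA h0 ha m
        rw [hz] at h1
        exact D.emb_injective (k := k) x i (h1.trans (map_zero _).symm)
      | succ n ih =>
        intro a h0 ha m
        rcases ((D.mem_sp_act hA h0 (by omega)).1 (repSp_mem (h.conj h f m) _)).2 with hs | h1
        swap
        · exact h1
        let q := repMk (D.sp E) (vtx T.t T.ℓ i (a + 1)) (0, (m.1 (vtx T.t T.ℓ i a)).2)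
          ((D.mem_sp_act hA (by omega) (by omega)).2 ⟨Or.inr rfl, Or.inl (by omega)⟩)
        have hq : q.1 (vtx T.t T.ℓ i (a + 1)) = (0, (m.1 (vtx T.t T.ℓ i a)).2) :=
          repMk_same _ _ _ _
        have h2 := h.conj_arrow h f (i := i) (j := a) (by omega) (m := m) (n := q) (by
          rw [hq, D.phi_mid x hA h0 (by omega) hs])
        rw [D.phi_mid x hA h0 (by omega) hs] at h2
        exact (congrArg Prod.snd h2).symm.trans (ih (a + 1) (by omega) (by omega) q)
    rw [← hff]
    exact c1 _ (c2 (T.ℓ i - 1 - a) a h0 (by omega) m)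
  have hF : ∀ m, h.conj h f m = 0 := by
    intro m
    refine Subtype.ext (funext fun v => ?_)
    match v with
    | .src => exact (conj_src h f m).trans (hz _)
    | .snk => exact (conj_snk h f m).trans (hz _)
    | .mid i a =>
      have h1 := key i (a + 1) (Nat.succ_pos _) (by omega) m
      rwa [vtx_mid (Nat.succ_pos _) (by omega)] at h1
  refine LinearMap.ext fun m => Ψ.injective ?_
  have h1 := hF (Ψ m)
  rw [h.conj_apply h, AddEquiv.symm_apply_apply] at h1
  rw [h1, LinearMap.zero_apply, map_zero]

lemma indec [Nontrivial E] (h : Realizes T (D.phi_mem x) M Ψ)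
    (hx : ∀ g : E →ₗ[k] E, (∀ z, g (x * z) = x * g z) → ∀ z, g z = g 1 * z)
    (hid : ∀ p : E, p * p = p → p = 0 ∨ p = 1) : Indec (Alg T)ᵐᵒᵖ M := by
  refine ⟨⟨Ψ.symm (srcMk D 1), 0, fun h1 => ?_⟩, fun f hf => ?_⟩
  · rw [AddEquiv.symm_apply_eq, map_zero] at h1
    have h2 := congrArg (fun m => m.1 .src) h1
    rw [srcMk_src] at h2
    exact one_ne_zero h2
  obtain ⟨p, hp⟩ := exists_srcEnd_eq h f hx
  have hpp : p * p = p := by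
    have h1 : srcEnd h f (srcEnd h f (1, 1)) = srcEnd h f (1, 1) := by
      conv_lhs => rw [srcEnd, srcEnd]
      rw [← srcEnd, ← conj_src h f, h.conj_apply h, h.conj_apply h,
        AddEquiv.symm_apply_apply]
      exact congrArg (fun n => (Ψ n).1 .src) (LinearMap.congr_fun hf _)
    simpa [hp] using congrArg Prod.fst h1
  rcases hid p hpp with rfl | rfl
  · exact Or.inl (eq_zero_of_srcEnd h f hf fun w => by simp [hp])
  · right
    have h1 : (LinearMap.id - f).comp (LinearMap.id - f) = LinearMap.id - f := by
      rw [LinearMap.sub_comp, LinearMap.comp_sub, LinearMap.comp_sub, hf]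
      simp
    have h2 : LinearMap.id - f = 0 := eq_zero_of_srcEnd h _ h1 fun w => by
      have h3 : srcEnd h (LinearMap.id - f) w = w - srcEnd h f w := by
        rw [srcEnd, srcEnd, h.conj_apply h, h.conj_apply h, LinearMap.sub_apply, map_sub,
          LinearMap.id_apply, AddEquiv.apply_symm_apply]
        exact congrArg (· - srcEnd h f w) (srcMk_src (D := D) w)
      rw [h3, hp]
      simp
    exact (sub_eq_zero.1 h2).symm

end ZeroPair

end Indecomposable

section Parts

variable {k : Type u} [Field k] {T : ToupieAlg k}

lemma eV_mul_eV (v : Vtx T.t T.ℓ) : (eV v * eV v : PathAlg k T.t T.ℓ) = eV v := isRep_self.idem v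

lemma subE_succ (i : Fin T.t) (a : ℕ) : (subE i a (a + 1) : PathAlg k T.t T.ℓ) = arE i a := by
  rw [subE_eq, icoProd_succ]

lemma eV_mul_subE (i : Fin T.t) {a b : ℕ} (hab : a < b) (hb : b ≤ T.ℓ i) :
    (eV (vtx T.t T.ℓ i a) * subE i a b : PathAlg k T.t T.ℓ) = subE i a b :=
  isRep_self.start_mul (.sub i a b hab hb)

lemma subE_mul_eV (i : Fin T.t) {a b : ℕ} (hab : a < b) (hb : b ≤ T.ℓ i) :
    (subE i a b * eV (vtx T.t T.ℓ i b) : PathAlg k T.t T.ℓ) = subE i a b :=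
  isRep_self.mul_end (.sub i a b hab hb)

namespace ZeroPair

variable {D : ZeroPair T} {E : Type u} [CommRing E] [Algebra k E] {x : E}
  {M : ModuleCat.{u} (Alg T)ᵐᵒᵖ} {Ψ : M ≃+ RepSp (D.sp E)}

lemma not_inLeftPart [Nontrivial E] (h : Realizes T (D.phi_mem x) M Ψ) :
    ¬ InLeftPart (Alg T)ᵐᵒᵖ M := by
  have hw : (wE D.i₁ : PathAlg k T.t T.ℓ) ∈ T.I := D.mem _ (Or.inl rfl)
  have hl := two_le_of_mem hw
  have hex : ∃ b, 1 < b ∧ b ≤ T.ℓ D.i₁ ∧ subE D.i₁ 0 b ∈ T.I := ⟨T.ℓ D.i₁, hl, le_rfl, hw⟩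
  obtain ⟨hb1, hb, hbI⟩ := Nat.find_spec hex
  have hmin := fun a (ha : a < Nat.find hex) => Nat.find_min hex ha
  obtain ⟨b, hbe⟩ : ∃ b, Nat.find hex = b + 1 := ⟨Nat.find hex - 1, by omega⟩
  rw [hbe] at hb1 hb hbI hmin
  have h0 : 0 < b := by omega
  have hu : subE D.i₁ 0 b ∉ T.I := by
    intro hu
    rcases (show 1 ≤ b from h0).eq_or_lt with h1 | h1
    · exact subE_succ_notMem T (by omega) h0 (by omega) hu
    · exact hmin b (Nat.lt_succ_self b) ⟨h1, by omega, hu⟩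
  have hsrc : ∀ w : E × E, op (mkA T (eV Vtx.src)) • Ψ.symm (srcMk D w) = Ψ.symm (srcMk D w) := by
    intro w
    rw [← AddEquiv.apply_eq_iff_eq Ψ, h.eV_smul, AddEquiv.apply_symm_apply]
    exact repE_repMk (D.sp E) .src w trivial
  refine Toupie.not_inLeftPart (k := k) (e := op (mkA T (eV Vtx.src)))
    (u := op (mkA T (subE D.i₁ 0 b))) (m := Ψ.symm (srcMk D (0, 1)))
    (y := Ψ.symm (srcMk D (1, 0))) ?_ ?_ ?_ ?_ (hsrc _) ?_ ?_ (hsrc _) ?_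
  · rw [← op_mul, ← map_mul, eV_mul_eV]
  · have h1 := eV_mul_subE (k := k) D.i₁ h0 (by omega)
    rw [vtx_zero] at h1
    rw [← op_mul, ← map_mul, h1]
  · intro r
    obtain ⟨r, rfl⟩ := op_surjective r
    obtain ⟨r, rfl⟩ := mkA_surjective T r
    refine ⟨coef (.vert .src) r, ?_⟩
    rw [← op_mul, ← op_mul, ← map_mul, ← map_mul, ← mul_assoc, eV_mul_mul_eV_self, mkA_smul,
      op_smul]
  · intro z hz
    obtain ⟨z, rfl⟩ := op_surjective z
    obtain ⟨z, rfl⟩ := mkA_surjective T z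
    refine ⟨op (mkA T (arE D.i₁ b)), ?_, fun h1 => hu ?_⟩
    · rw [← op_mul, ← map_mul, ← subE_succ, subE_mul_subE T _ (Nat.zero_le b) (Nat.le_succ b),
        (mkA_eq_zero_iff T).2 hbI, op_zero]
    · rw [← op_mul, ← map_mul, op_eq_zero_iff, mkA_eq_zero_iff] at h1
      rw [← op_mul, ← map_mul, op_inj] at hz
      exact mem_of_mul_sub_mem T (by omega) (subE_mul_eV D.i₁ h0 (by omega)) h1 hz
  · rw [← AddEquiv.apply_eq_iff_eq Ψ, map_zero]
    refine Subtype.ext (funext fun w => ?_)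
    rw [h.subE_smul D.i₁ h0 (by omega), AddEquiv.apply_symm_apply, vtx_zero, srcMk_src,
      pathMap_cons _ h0, D.phi_zero x (Or.inl rfl), proj_i₁]
    split_ifs
    · exact map_zero _
    · rfl
  · intro h1
    rw [AddEquiv.symm_apply_eq, map_zero] at h1
    have h2 := congrArg (fun m => (m.1 .src).2) h1
    rw [srcMk_src] at h2
    exact one_ne_zero h2
  · intro r h1
    rw [Algebra.smul_def, mul_smul, hsrc, ← AddEquiv.apply_eq_iff_eq Ψ, h.algebraMap_smul,
      AddEquiv.apply_symm_apply, AddEquiv.apply_symm_apply] at h1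
    have h2 := congrArg (fun m => (m.1 .src).1) h1
    change ((srcMk D (1, 0)).1 .src).1 = (r • (srcMk D (0, 1)).1 .src).1 at h2
    rw [srcMk_src, srcMk_src, Prod.smul_mk, smul_zero] at h2
    exact one_ne_zero h2

lemma not_inRightPart [Nontrivial E] (h : Realizes T (D.phi_mem x) M Ψ) {a b : ℕ}
    (hab : a + 2 ≤ b) (hb : b ≤ T.ℓ D.i₁) (hI : subE D.i₁ a b ∈ T.I)
    (hmin : ∀ c, a < c → c < b → subE D.i₁ a c ∉ T.I)
    (hnz : subE D.i₁ (a + 1) (T.ℓ D.i₁) ∉ T.I) (hs : D.s D.i₁ = min b (T.ℓ D.i₁ - 1)) :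
    ¬ InRightPart (Alg T)ᵐᵒᵖ M := by
  rintro ⟨hM, hfd, hid⟩
  have hA : D.Act D.i₁ := Or.inl rfl
  have hab' : a + 1 < b := by omega
  obtain ⟨z, hzS, hz⟩ : ∃ z ∈ D.sp E (vtx T.t T.ℓ D.i₁ b), ∀ w : E × E,
      z ≠ pathMap (D.phi x) D.i₁ (a + 1) b w := by
    obtain ⟨j, rfl⟩ : ∃ j, b = j + 1 := ⟨b - 1, by omega⟩
    simp only [pathMap_succ D.i₁ (Nat.lt_succ_iff.1 hab')]
    rcases hb.eq_or_lt with h1 | h1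
    · refine ⟨(1, 0), ?_, fun w hw => ?_⟩
      · rw [h1, D.sp_end]
        trivial
      · rw [D.phi_last x hA (by omega) h1, emb_i₁] at hw
        exact one_ne_zero ((congrArg Prod.fst hw).trans (congrArg Prod.snd hw).symm)
    · refine ⟨(0, 1), ?_, fun w hw => ?_⟩
      · exact (D.mem_sp_act hA (by omega) h1).2 ⟨Or.inr rfl, Or.inl (by omega)⟩
      · rw [D.phi_early x hA (by omega) h1 (by omega)] at hw
        exact one_ne_zero (congrArg Prod.snd hw)
  refine not_idLeOne (v := op (mkA T (subE D.i₁ (a + 1) b))) (α := op (mkA T (arE D.i₁ a)))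
    (e := op (mkA T (eV (vtx T.t T.ℓ D.i₁ (a + 1))))) (f := op (mkA T (eV (vtx T.t T.ℓ D.i₁ b))))
    (y := Ψ.symm (repMk (D.sp E) _ z hzS)) ?_ ?_ ?_ ?_ ?_ ?_ ?_ (hid M hM hfd .refl)
  · rw [← op_mul, ← map_mul, ← subE_succ, subE_mul_subE T _ (Nat.le_succ a) hab'.le,
      (mkA_eq_zero_iff T).2 hI, op_zero]
  · rw [← op_mul, ← map_mul, eV_mul_eV]
  · rw [← op_mul, ← map_mul, eV_mul_subE _ hab' hb]
  · intro r hr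
    obtain ⟨r, rfl⟩ := op_surjective r
    obtain ⟨r, rfl⟩ := mkA_surjective T r
    rw [← op_mul, ← map_mul, op_eq_zero_iff, mkA_eq_zero_iff] at hr
    obtain ⟨y, hy⟩ := exists_of_arE_mul_mem T hab hb hmin hr
    refine ⟨op (mkA T y), ?_⟩
    rw [← op_mul, ← op_mul, ← map_mul, ← map_mul, hy]
  · intro r hr
    obtain ⟨r, rfl⟩ := op_surjective r
    obtain ⟨r, rfl⟩ := mkA_surjective T r
    rw [← op_mul, ← map_mul, op_eq_zero_iff, mkA_eq_zero_iff] at hr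
    rw [← op_mul, ← map_mul, eV_mul_eq_zero_of_subE_mul_mem T hab' hb hnz hr, map_zero, op_zero]
  · rw [← AddEquiv.apply_eq_iff_eq Ψ, h.eV_smul, AddEquiv.apply_symm_apply]
    exact repE_repMk _ _ _ _
  · intro m hm
    rw [← AddEquiv.apply_eq_iff_eq Ψ, AddEquiv.apply_symm_apply] at hm
    have h1 := congrArg (fun n => n.1 (vtx T.t T.ℓ D.i₁ b)) hm
    rw [repMk_same, h.subE_smul D.i₁ hab' hb, if_pos rfl] at h1
    exact hz _ h1

end ZeroPair

lemma exists_zeroPair (hm : mDim T = 1) {i j : Fin T.t} (hij : j ≠ i) (hi : branchInI T i)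
    (hj : branchInI T j) : ∃ D : ZeroPair T, ∃ a b, a + 2 ≤ b ∧ b ≤ T.ℓ D.i₁ ∧
      subE D.i₁ a b ∈ T.I ∧ (∀ c, a < c → c < b → subE D.i₁ a c ∉ T.I) ∧
      subE D.i₁ (a + 1) (T.ℓ D.i₁) ∉ T.I ∧ D.s D.i₁ = min b (T.ℓ D.i₁ - 1) := by
  obtain ⟨c, hc, Λ, hΛ⟩ := exists_branch_of_mDim T hm
  have hli := ZeroPair.two_le_of_mem hi
  have hlj := ZeroPair.two_le_of_mem hj
  let P : ℕ → Prop := fun a => subE i a (T.ℓ i) ∈ T.I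
  obtain ⟨a, ha⟩ : ∃ a, Nat.findGreatest P (T.ℓ i - 1) = a := ⟨_, rfl⟩
  have hPa : P a := by
    rw [← ha]
    exact Nat.findGreatest_spec (m := 0) (Nat.zero_le _) hi
  have hal : a ≤ T.ℓ i - 1 := ha ▸ Nat.findGreatest_le _
  have hal' : a + 2 ≤ T.ℓ i := by
    by_contra hlt
    exact subE_succ_notMem T (by omega) (by omega) le_rfl hPa
  have hnz : subE i (a + 1) (T.ℓ i) ∉ T.I :=
    Nat.findGreatest_is_greatest (P := P) (n := T.ℓ i - 1) (by omega) (by omega)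
  have hex : ∃ b, a < b ∧ b ≤ T.ℓ i ∧ subE i a b ∈ T.I := ⟨T.ℓ i, by omega, le_rfl, hPa⟩
  obtain ⟨hab, hb, hbI⟩ := Nat.find_spec hex
  have hmin := fun n (hn : n < Nat.find hex) => Nat.find_min hex hn
  generalize Nat.find hex = b at hab hb hbI hmin
  have hab' : a + 2 ≤ b := by
    by_contra hlt
    exact subE_succ_notMem T (by omega) hab hb hbI
  refine ⟨{ c := c, Λ := Λ, hc := hc, hΛ := hΛ, i₁ := i, i₂ := j, hne := hij,
            s := fun n => if n = i then min b (T.ℓ i - 1) else T.ℓ n - 1,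
            mem := ?_, one_le := ?_, lt := ?_, notMem := ?_ }, a, b, hab', hb, hbI,
            fun n h1 h2 h3 => hmin n h2 ⟨h1, by omega, h3⟩, hnz, if_pos rfl⟩
  · rintro n (rfl | rfl)
    exacts [hi, hj]
  · rintro n (rfl | rfl)
    · rw [if_pos rfl]; omega
    · rw [if_neg hij]; omega
  · rintro n (rfl | rfl)
    · rw [if_pos rfl]; omega
    · rw [if_neg hij]; omega
  · rintro n (rfl | rfl)
    · rw [if_pos rfl]
      intro h1
      refine hnz ?_
      rw [← subE_mul_subE T n (b := min b (T.ℓ n - 1)) (by omega) (by omega)]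
      exact T.I.mul_mem_left _ _ h1
    · rw [if_neg hij]
      exact subE_succ_notMem T (by omega) (by omega) le_rfl

end Parts

section TruncatedPolynomials

open Polynomial

variable (k : Type u) [Field k]

lemma idem_adjoinRoot_X_pow (n : ℕ) (p : AdjoinRoot (X ^ n : k[X])) (hp : p * p = p) :
    p = 0 ∨ p = 1 := by
  obtain ⟨q, rfl⟩ := AdjoinRoot.mk_surjective p
  have h1 : (X : k[X]) ^ n ∣ q * (q - 1) := by
    rw [mul_sub, mul_one, ← AdjoinRoot.mk_eq_mk, map_mul, hp]
  by_cases hq : (X : k[X]) ∣ q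
  · left
    refine AdjoinRoot.mk_eq_zero.2 (prime_X.pow_dvd_of_dvd_mul_right n (fun h2 => ?_) h1)
    have h3 : (X : k[X]) ∣ 1 := by simpa using dvd_sub hq h2
    exact prime_X.not_dvd_one h3
  · right
    rw [← map_one (AdjoinRoot.mk _), AdjoinRoot.mk_eq_mk]
    exact prime_X.pow_dvd_of_dvd_mul_left n hq h1

lemma eq_mul_of_commute_root {f : k[X]} (g : AdjoinRoot f →ₗ[k] AdjoinRoot f)
    (hg : ∀ z, g (AdjoinRoot.root f * z) = AdjoinRoot.root f * g z) (z : AdjoinRoot f) :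
    g z = g 1 * z := by
  have key : ∀ a ∈ Algebra.adjoin k {AdjoinRoot.root f}, ∀ z, g (a * z) = a * g z := by
    intro a ha
    induction ha using Algebra.adjoin_induction with
    | mem a ha =>
      rw [Set.mem_singleton_iff.1 ha]
      exact hg
    | algebraMap r =>
      intro z
      rw [← Algebra.smul_def, map_smul, Algebra.smul_def]
    | add a b _ _ ha hb =>
      intro z
      rw [add_mul, map_add, ha, hb, add_mul]
    | mul a b _ _ ha hb =>
      intro z
      rw [mul_assoc, ha, hb, mul_assoc]
  have h1 := key z (by rw [AdjoinRoot.adjoinRoot_eq_top]; trivial) 1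
  rwa [mul_one, mul_comm] at h1

lemma finrank_adjoinRoot_X_pow (n : ℕ) :
    Module.finrank k (AdjoinRoot (X ^ n : k[X])) = n := by
  rw [(AdjoinRoot.powerBasis (pow_ne_zero n X_ne_zero)).finrank, AdjoinRoot.powerBasis_dim,
    natDegree_X_pow]

end TruncatedPolynomials

/-- Two distinct branches in the ideal prevent a toupie algebra with `dim e₀ A e∞ = 1` from
being laura. -/
lemma not_laura_of_two_branches {k : Type u} [Field k] {T : ToupieAlg k} (hm : mDim T = 1)
    {i j : Fin T.t} (hij : j ≠ i) (hi : branchInI T i) (hj : branchInI T j) :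
    ¬ Laura (Alg T)ᵐᵒᵖ := by
  rintro ⟨S, hS, hlaura⟩
  obtain ⟨D, a, b, hab, hb, hI, hmin, hnz, hs⟩ := exists_zeroPair hm hij hi hj
  let E : ℕ → Type u := fun n => AdjoinRoot (Polynomial.X ^ (n + 1) : Polynomial k)
  have hne : ∀ n, (Polynomial.X ^ (n + 1) : Polynomial k) ≠ 0 :=
    fun n => pow_ne_zero _ Polynomial.X_ne_zero
  have hfin : ∀ n, Module.Finite k (E n) := fun n => (AdjoinRoot.powerBasis (hne n)).finite
  have hnt : ∀ n, Nontrivial (E n) := fun n => AdjoinRoot.nontrivial _ (by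
    rw [Polynomial.degree_X_pow]
    exact_mod_cast n.succ_ne_zero)
  choose M Ψ h using fun n =>
    D.exists_realizes (AdjoinRoot.root (Polynomial.X ^ (n + 1) : Polynomial k))
  have hN : ∀ n, ∃ N : S, Nonempty (M n ≃ₗ[(Alg T)ᵐᵒᵖ] N.1) := by
    intro n
    have := hfin n
    have := hnt n
    obtain ⟨N, hNS, hN⟩ := hlaura (M n)
      (ZeroPair.indec (h n) (eq_mul_of_commute_root k) (idem_adjoinRoot_X_pow k _))
      (h n).fdMod (ZeroPair.not_inLeftPart (h n))
      (ZeroPair.not_inRightPart (h n) hab hb hI hmin hnz hs)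
    exact ⟨⟨N, hNS⟩, hN⟩
  choose N e using hN
  have := hS.to_subtype
  obtain ⟨n, m, hnm, hNnm⟩ := Finite.exists_ne_map_eq_of_infinite N
  obtain ⟨e₁⟩ := e n
  obtain ⟨e₂⟩ := e m
  rw [← hNnm] at e₂
  have h1 := (h n).finrank_eq (h m) (e₁.trans e₂.symm) .src (fun _ => trivial) fun _ => trivial
  have := hfin n
  have := hfin m
  rw [Module.finrank_prod, Module.finrank_prod, finrank_adjoinRoot_X_pow,
    finrank_adjoinRoot_X_pow] at h1
  omega

end Toupie

namespace Toupie

/-- Let `A = kQ/I` be a non simply connected toupie algebra with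
`m = dim_k e₀ A e∞ = 1` such that the branch `w i₀` lies in `I`.  If `A` is a laura
algebra, then `w i₀` is the unique branch lying in `I`. -/
theorem unique_branch_in_ideal_of_laura {k : Type u} [Field k] (T : ToupieAlg k)
    (hnsc : ¬ SimplyConnected T) (hm : mDim T = 1) (i₀ : Fin T.t)
    (hb : branchInI T i₀) (hlaura : Laura (Alg T)ᵐᵒᵖ) :
    ∀ j : Fin T.t, branchInI T j → j = i₀ := by
  intro j hj
  by_contra hne
  exact not_laura_of_two_branches hm hne hb hj hlaura

end Toupie
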